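/- Let m ≥ 2 and let {Λ_t}_{t∈[0,1]} be a non-negative Legendrian isotopy in ℝ^m × S^{m-1} ≅ ST*ℝ^m such that Λ_0 ∩ Λ_1 = ∅. Then the ordered two-component Legendrian link (Λ_0, Λ_1) is not Legendrian isotopic to any link ({x} × S^{m-1}, {y} × S^{m-1}) formed by two distinct fibres of ST*ℝ^m (x ≠ y). -/

import Mathlib

/-!
STATEMENT 9: If `{Λ_t}_{t∈[0,1]}` is a non-negative Legendrian isotopy in
`ST*ℝ^m ≅ ℝ^m × S^{m-1}` with `Λ_0 ∩ Λ_1 = ∅`, then the ordered two-component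
Legendrian link `(Λ_0, Λ_1)` is not Legendrian isotopic to any link
`({x} × S^{m-1}, {y} × S^{m-1})` formed by two distinct fibres of `ST*ℝ^m`.
This is the contact-geometric core of Theorem A (the Legendrian Low conjecture).

Conventions for representing Legendrian isotopies in `ST*ℝ^m`, parameterised by the
sphere via smooth ambient maps `F : ℝ^m × ℝ → ℝ^m × ℝ^m`, are as in Statement 8.
Two ordered two-component links are Legendrian isotopic if there are Legendrian
isotopies connecting the respective components that keep the two components disjoint
at every time.
-/

noncomputable section

open Set Metric
open scoped RealInnerProductSpace

/-- The unit sphere `S^{m-1} ⊂ ℝ^m`. -/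
def sph (m : ℕ) : Set (EuclideanSpace ℝ (Fin m)) := Metric.sphere (0 : EuclideanSpace ℝ (Fin m)) 1

/-- Ambient model `ℝ^m × ℝ^m` of `ST*ℝ^m ≅ ℝ^m × S^{m-1}`. -/
abbrev STSp (m : ℕ) := EuclideanSpace ℝ (Fin m) × EuclideanSpace ℝ (Fin m)

/-- `F : ℝ^m × ℝ → ℝ^m × ℝ^m` represents a Legendrian isotopy `{Λ_t}_{t∈[0,1]}` in
`ST*ℝ^m ≅ ℝ^m × S^{m-1}` parameterised by the sphere: it is smooth, maps
`S^{m-1} × [0,1]` into `ℝ^m × S^{m-1}`, each `F_t|_{S^{m-1}}` is an injective immersion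
(hence an embedding of the compact sphere) onto `Λ_t`, and each `Λ_t` is Legendrian:
every tangent vector `(v,w)` of `Λ_t` at `(x,q)` satisfies `⟨v,q⟩ = 0`. -/
structure IsLegIsotopyST (m : ℕ) (F : EuclideanSpace ℝ (Fin m) × ℝ → STSp m) : Prop where
  smooth : ContDiff ℝ (⊤ : ℕ∞) F
  mem_sphere : ∀ s ∈ sph m, ∀ t ∈ Icc (0:ℝ) 1, (F (s, t)).2 ∈ sph m
  inj : ∀ t ∈ Icc (0:ℝ) 1, InjOn (fun s => F (s, t)) (sph m)
  imm : ∀ t ∈ Icc (0:ℝ) 1, ∀ s ∈ sph m, ∀ v : EuclideanSpace ℝ (Fin m),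
    ⟪v, s⟫ = 0 → v ≠ 0 → fderiv ℝ (fun s' => F (s', t)) s v ≠ 0
  leg : ∀ t ∈ Icc (0:ℝ) 1, ∀ s ∈ sph m, ∀ v : EuclideanSpace ℝ (Fin m), ⟪v, s⟫ = 0 →
    ⟪(fderiv ℝ (fun s' => F (s', t)) s v).1, (F (s, t)).2⟫ = 0

/-- Non-negativity of the Legendrian isotopy: `⟨∂x/∂t, q⟩ ≥ 0`. -/
def NonnegST (m : ℕ) (F : EuclideanSpace ℝ (Fin m) × ℝ → STSp m) : Prop :=
  ∀ s ∈ sph m, ∀ t ∈ Icc (0:ℝ) 1,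
    0 ≤ ⟪deriv (fun t' => (F (s, t')).1) t, (F (s, t)).2⟫

/-- The slice `Λ_t = F_t(S^{m-1})` of the isotopy. -/
def stSlice (m : ℕ) (F : EuclideanSpace ℝ (Fin m) × ℝ → STSp m) (t : ℝ) : Set (STSp m) :=
  (fun s => F (s, t)) '' sph m

/-- The fibre `{x} × S^{m-1}` of `ST*ℝ^m` over `x`. -/
def fib (m : ℕ) (x : EuclideanSpace ℝ (Fin m)) : Set (STSp m) :=
  {x} ×ˢ sph m

/-- The ordered links `(A, B)` and `(A', B')` in `ST*ℝ^m` are Legendrian isotopic: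
there are Legendrian isotopies connecting `A` to `A'` and `B` to `B'` whose time
slices are disjoint at every time `t ∈ [0,1]`. -/
def LegLinkIsotopic (m : ℕ) (A B A' B' : Set (STSp m)) : Prop :=
  ∃ G G' : EuclideanSpace ℝ (Fin m) × ℝ → STSp m,
    IsLegIsotopyST m G ∧ IsLegIsotopyST m G' ∧
    stSlice m G 0 = A ∧ stSlice m G' 0 = B ∧
    stSlice m G 1 = A' ∧ stSlice m G' 1 = B' ∧
    ∀ t ∈ Icc (0:ℝ) 1, stSlice m G t ∩ stSlice m G' t = ∅

section Brouwer

open MeasureTheory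

/-- `det (1 + t • A)` is a polynomial in `t` of degree at most the dimension. -/
lemma exists_polynomial_eval_eq_det_one_add_smul {V : Type*} [AddCommGroup V] [Module ℝ V]
    [FiniteDimensional ℝ V] (A : V →ₗ[ℝ] V) :
    ∃ P : Polynomial ℝ, P.natDegree ≤ Module.finrank ℝ V ∧
      ∀ t : ℝ, P.eval t = LinearMap.det (1 + t • A) := by
  classical
  let b := Module.finBasis ℝ V
  let M := LinearMap.toMatrix b b A
  refine ⟨((Polynomial.X : Polynomial ℝ) • M.map Polynomial.C +
    (1 : Matrix _ _ ℝ).map Polynomial.C).det, ?_, fun t => ?_⟩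
  · simpa using Polynomial.natDegree_det_X_add_C_le M 1
  · rw [← LinearMap.det_toMatrix b, ← Polynomial.coe_evalRingHom, RingHom.map_det]
    congr 1
    simp only [map_add, map_smul, LinearMap.toMatrix_one]
    ext i j
    by_cases h : i = j <;> simp [h, M, add_comm, mul_comm t]

/-- A polynomial function of degree at most `d`, evaluated at `1`, is a fixed combination of its
values at `d + 1` small points, with coefficients of sum one. -/
lemma exists_extrapolation (d : ℕ) {δ : ℝ} (hδ : 0 < δ) :
    ∃ (τ c : Fin (d + 1) → ℝ), (∀ i, 0 < τ i ∧ τ i < δ) ∧ ∑ i, c i = 1 ∧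
      ∀ P : Polynomial ℝ, P.natDegree ≤ d → P.eval 1 = ∑ i, c i * P.eval (τ i) := by
  classical
  let τ : Fin (d + 1) → ℝ := fun i => δ * ((i : ℝ) + 1) / (d + 2)
  have hd : (0 : ℝ) < d + 2 := by positivity
  have hinj : Function.Injective τ := by
    intro i j h
    simp only [τ] at h
    field_simp at h
    exact Fin.ext (by exact_mod_cast (by linarith : (i : ℝ) = j))
  refine ⟨τ, fun i => (Lagrange.basis Finset.univ τ i).eval 1, fun i => ⟨by positivity, ?_⟩, ?_, ?_⟩
  · have : (i : ℝ) + 1 < d + 2 := by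
      have : ((i : ℕ) : ℝ) < ((d + 1 : ℕ) : ℝ) := by exact_mod_cast i.2
      push_cast at this
      linarith
    simp only [τ]
    rw [div_lt_iff₀ hd]
    exact mul_lt_mul_of_pos_left this hδ
  · rw [← Polynomial.eval_finsetSum, Lagrange.sum_basis hinj.injOn Finset.univ_nonempty]
    simp
  · intro P hP
    have h := Lagrange.eq_interpolate_of_eval_eq (s := Finset.univ) (v := τ)
      (fun i => P.eval (τ i)) (f := P) hinj.injOn
      (by
        refine lt_of_le_of_lt (Polynomial.degree_le_of_natDegree_le hP) ?_
        simp only [Finset.card_univ, Fintype.card_fin]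
        exact_mod_cast Nat.lt_succ_self d) (by simp)
    conv_lhs => rw [h]
    rw [Lagrange.interpolate_apply, Polynomial.eval_finsetSum]
    exact Finset.sum_congr rfl fun i _ => by simp [mul_comm]

variable {E : Type*} [NormedAddCommGroup E] [InnerProductSpace ℝ E] [FiniteDimensional ℝ E]

omit [FiniteDimensional ℝ E] in
lemma lipschitzWith_indicator_closedBall {K : NNReal} {R : ℝ} {k : E → E}
    (hk : LipschitzOnWith K k (closedBall 0 R)) (h0 : ∀ v, ‖v‖ = R → k v = 0) :
    LipschitzWith K ((closedBall (0 : E) R).indicator k) := by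
  classical
  have key : ∀ u v : E, u ∈ closedBall (0 : E) R → v ∉ closedBall (0 : E) R →
      dist (k u) 0 ≤ K * dist u v := by
    intro u v hu hv
    have hu' : ‖u‖ ≤ R := by simpa using hu
    have hv' : R < ‖v‖ := by simpa using hv
    have hc : ContinuousOn (fun s : ℝ => ‖AffineMap.lineMap (k := ℝ) u v s‖) (Icc 0 1) := by
      refine Continuous.continuousOn ?_
      exact continuous_norm.comp AffineMap.lineMap_continuous
    obtain ⟨s, hs, hsR⟩ := intermediate_value_Icc (zero_le_one (α := ℝ)) hc
      (show R ∈ Icc _ _ by simpa using ⟨hu', hv'.le⟩)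
    set w := AffineMap.lineMap (k := ℝ) u v s with hw
    have hwR : ‖w‖ = R := hsR
    have h1 := hk.dist_le_mul u hu w (by simp [hwR])
    rw [h0 w hwR] at h1
    refine h1.trans ?_
    gcongr
    rw [hw, dist_left_lineMap]
    have : ‖s‖ ≤ 1 := by rw [Real.norm_eq_abs, abs_le]; constructor <;> linarith [hs.1, hs.2]
    exact mul_le_of_le_one_left dist_nonneg this
  refine LipschitzWith.of_dist_le_mul fun u v => ?_
  by_cases hu : u ∈ closedBall (0 : E) R <;> by_cases hv : v ∈ closedBall (0 : E) R
  · rw [indicator_of_mem hu, indicator_of_mem hv]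
    exact hk.dist_le_mul u hu v hv
  · rw [indicator_of_mem hu, indicator_of_notMem hv]
    exact key u v hu hv
  · rw [indicator_of_notMem hu, indicator_of_mem hv, dist_comm, dist_comm u]
    exact key v u hv hu
  · rw [indicator_of_notMem hu, indicator_of_notMem hv, dist_self]
    positivity

/-- There is no `C¹` retraction of a ball onto its boundary sphere. -/
lemma no_retraction {R : ℝ} (hR : 0 < R) (r : E → E) (hr : ContDiff ℝ 1 r)
    (hnorm : ∀ v, ‖r v‖ = R) (hid : ∀ v, ‖v‖ = R → r v = v) : False := by
  classical
  let _ : MeasurableSpace E := borel E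
  have : BorelSpace E := ⟨rfl⟩
  have hvne : ∃ v : E, v ≠ 0 := by
    refine ⟨r 0, fun h => ?_⟩
    have := hnorm 0
    rw [h, norm_zero] at this
    exact hR.ne this
  have : Nontrivial E := ⟨⟨_, 0, hvne.choose_spec⟩⟩
  set B := closedBall (0 : E) R with hB
  have hkc : ContDiff ℝ 1 (fun v => r v - v) := hr.sub contDiff_id
  obtain ⟨K, hK⟩ : ∃ K : NNReal, LipschitzOnWith K (fun v => r v - v) B := by
    obtain ⟨C, hC⟩ := (isCompact_closedBall (0 : E) R).exists_bound_of_continuousOn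
      (hkc.continuous_fderiv one_ne_zero).continuousOn
    refine ⟨C.toNNReal, (convex_closedBall 0 R).lipschitzOnWith_of_nnnorm_fderiv_le
      (fun x _ => (hkc.differentiable one_ne_zero).differentiableAt) fun x hx => ?_⟩
    rw [← NNReal.coe_le_coe]
    exact (hC x hx).trans (Real.le_coe_toNNReal C)
  have hkL := lipschitzWith_indicator_closedBall hK (fun v hv => by simp [hid v hv])
  set k : E → E := B.indicator (fun v => r v - v) with hk
  let f' : E → E →L[ℝ] E := fun v => fderiv ℝ r v - ContinuousLinearMap.id ℝ E
  have hf' : ∀ v, HasFDerivAt (fun v => r v - v) (f' v) v := fun v =>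
    ((hr.differentiable one_ne_zero) v).hasFDerivAt.sub (hasFDerivAt_id v)
  -- small times
  have hsmall : ∀ t : ℝ, 0 < t → t < 1 / (K + 1) →
      ∫ v in B, (1 + t • f' v).det = volume.real B := by
    intro t ht0 ht
    have htK : t * K < 1 := by
      rw [lt_div_iff₀ (by positivity)] at ht
      nlinarith
    set h : E → E := fun v => v + t • k v with hh
    have hlip : LipschitzWith (t.toNNReal * K) (fun v => t • k v) := by
      refine LipschitzWith.of_dist_le_mul fun u v => ?_
      rw [dist_smul₀, NNReal.coe_mul, Real.coe_toNNReal _ ht0.le, Real.norm_eq_abs,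
        abs_of_pos ht0, mul_assoc]
      gcongr
      exact hkL.dist_le_mul u v
    have happ : ApproximatesLinearOn h ((ContinuousLinearEquiv.refl ℝ E : E ≃L[ℝ] E) : E →L[ℝ] E)
        univ (t.toNNReal * K) := by
      intro u _ v _
      have := hlip.dist_le_mul u v
      rw [dist_eq_norm, dist_eq_norm] at this
      have he : h u - h v - (ContinuousLinearEquiv.refl ℝ E : E →L[ℝ] E) (u - v) =
          t • k u - t • k v := by
        simp only [hh, ContinuousLinearEquiv.coe_refl, ContinuousLinearMap.coe_id', id]
        abel
      rw [he]
      exact this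
    have hc : Subsingleton E ∨ t.toNNReal * K <
        ‖(((ContinuousLinearEquiv.refl ℝ E).symm : E ≃L[ℝ] E) : E →L[ℝ] E)‖₊⁻¹ := by
      right
      have : ‖(((ContinuousLinearEquiv.refl ℝ E).symm : E ≃L[ℝ] E) : E →L[ℝ] E)‖₊ = 1 := by
        ext
        simp
      rw [this, inv_one, ← NNReal.coe_lt_coe, NNReal.coe_mul, Real.coe_toNNReal _ ht0.le]
      exact htK
    let Φ := happ.toHomeomorph h hc
    have hΦ : ∀ v, Φ v = h v := fun v => rfl
    have hinj : Function.Injective h := fun u v huv => Φ.injective (by simpa [hΦ] using huv)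
    have hsurj : Function.Surjective h := Φ.surjective
    have hout : ∀ v, v ∉ B → h v = v := fun v hv => by simp [hh, hk, indicator_of_notMem hv]
    have ht1 : t < 1 := lt_of_lt_of_le ht (by
      rw [div_le_one (by positivity)]
      linarith [K.coe_nonneg])
    have himg : h '' B = B := by
      apply Subset.antisymm
      · rintro _ ⟨v, hv, rfl⟩
        by_contra hcon
        have := hout _ hcon
        exact hcon (by rw [hinj this]; exact hv)
      · intro w hw
        obtain ⟨v, rfl⟩ := hsurj w
        refine ⟨v, ?_, rfl⟩
        by_contra hv
        rw [hout v hv] at hw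
        exact hv hw
    have hder : ∀ v ∈ B, HasFDerivWithinAt h (1 + t • f' v) B v := by
      intro v hv
      have h1 : HasFDerivWithinAt (fun v => v + t • (r v - v)) (1 + t • f' v) B v :=
        ((hasFDerivAt_id v).add ((hf' v).const_smul t)).hasFDerivWithinAt
      refine h1.congr (fun w hw => ?_) ?_
      · simp [hh, hk, indicator_of_mem hw]
      · simp [hh, hk, indicator_of_mem hv]
    have hpos : ∀ v ∈ B, 0 < (1 + t • f' v).det := by
      intro v hv
      have hfK : ‖f' v‖ ≤ K := by
        rw [← (hf' v).fderiv]
        have hin : ∀ w ∈ ball (0 : E) R, ‖fderiv ℝ (fun v => r v - v) w‖ ≤ K := fun w hw =>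
          norm_fderiv_le_of_lipschitzOn ℝ
            (isOpen_ball.mem_nhds hw |> fun hn => Filter.mem_of_superset hn ball_subset_closedBall) hK
        have hcl : v ∈ closure (ball (0 : E) R) := by
          rw [closure_ball _ hR.ne']; exact hv
        exact closure_minimal (t := {w | ‖fderiv ℝ (fun v => r v - v) w‖ ≤ K}) hin
          (isClosed_le (hkc.continuous_fderiv one_ne_zero).norm continuous_const) hcl
      -- the determinant does not vanish along the segment from `1`
      have hne : ∀ s ∈ Icc (0 : ℝ) t, (1 + s • f' v).det ≠ 0 := by
        intro s hs
        have hlt : ‖-(s • f' v)‖ < 1 := by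
          rw [norm_neg, norm_smul, Real.norm_eq_abs, abs_of_nonneg hs.1]
          refine lt_of_le_of_lt ?_ htK
          gcongr
          exact hs.2
        have hu := isUnit_one_sub_of_norm_lt_one hlt
        rw [sub_neg_eq_add] at hu
        have hu2 : IsUnit (((1 + s • f' v : E →L[ℝ] E)) : E →ₗ[ℝ] E) :=
          hu.map (ContinuousLinearMap.toLinearMapRingHom (R₁ := ℝ) (M₁ := E))
        exact (LinearMap.isUnit_iff_isUnit_det _).1 hu2 |>.ne_zero
      by_contra hcon
      have hcont : ContinuousOn (fun s : ℝ => (1 + s • f' v).det) (Icc 0 t) := by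
        have : Continuous (fun s : ℝ => (1 + s • f' v).det) := by
          refine ContinuousLinearMap.continuous_det.comp ?_
          fun_prop
        exact this.continuousOn
      have h1 : (1 + (0 : ℝ) • f' v).det = 1 := by
        rw [zero_smul, add_zero]
        exact LinearMap.det_id
      obtain ⟨s, hs, hs0⟩ := intermediate_value_Icc' ht0.le hcont
        (show (0 : ℝ) ∈ Icc _ _ from ⟨not_lt.1 hcon, by rw [h1]; exact zero_le_one⟩)
      exact hne s hs hs0
    have hch := integral_image_eq_integral_abs_det_fderiv_smul volume
      measurableSet_closedBall hder hinj.injOn (fun _ => (1 : ℝ))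
    rw [himg] at hch
    simp only [smul_eq_mul, mul_one, integral_const, measureReal_restrict_apply_univ] at hch
    rw [hch]
    exact setIntegral_congr_fun measurableSet_closedBall fun v hv => (abs_of_pos (hpos v hv)).symm
  -- time one
  have hone : ∀ v, (1 + (1 : ℝ) • f' v).det = 0 := by
    intro v
    have h1 : (1 + (1 : ℝ) • f' v) = fderiv ℝ r v := by
      simp only [f', one_smul]
      ext w
      simp
    rw [h1]
    by_contra hdet
    have hu : IsUnit ((fderiv ℝ r v : E →L[ℝ] E) : E →ₗ[ℝ] E) :=
      (LinearMap.isUnit_iff_isUnit_det _).2 (isUnit_iff_ne_zero.2 hdet)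
    have hs : Function.Surjective (fderiv ℝ r v) := by
      have := (Module.End.isUnit_iff _).1 hu
      exact this.2
    obtain ⟨w, hw⟩ := hs (r v)
    have hd := ((hr.differentiable one_ne_zero) v).hasFDerivAt.norm_sq
    have hconst : HasFDerivAt (fun v => ‖r v‖ ^ 2) (0 : E →L[ℝ] ℝ) v := by
      simp only [hnorm]
      exact hasFDerivAt_const _ _
    have := congrArg (fun L : E →L[ℝ] ℝ => L w) (hd.unique hconst)
    simp [hw, hnorm] at this
    exact hR.ne' this
  obtain ⟨τ, c, hτ, hc, hP⟩ := exists_extrapolation (Module.finrank ℝ E)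
    (δ := 1 / ((K : ℝ) + 1)) (by positivity)
  have hpoint : ∀ v, (0 : ℝ) = ∑ i, c i * (1 + τ i • f' v).det := by
    intro v
    obtain ⟨P, hdeg, heval⟩ := exists_polynomial_eval_eq_det_one_add_smul (f' v : E →ₗ[ℝ] E)
    have h2 : ∀ t : ℝ, P.eval t = (1 + t • f' v).det := fun t => by
      rw [heval]; rfl
    rw [← hone v, ← h2, hP P hdeg]
    simp [h2]
  have hint : ∀ i, IntegrableOn (fun v => c i * (1 + τ i • f' v).det) B := by
    intro i
    refine ContinuousOn.integrableOn_compact (isCompact_closedBall _ _) (Continuous.continuousOn ?_)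
    refine continuous_const.mul (ContinuousLinearMap.continuous_det.comp ?_)
    have : Continuous f' := (hr.continuous_fderiv one_ne_zero).sub continuous_const
    fun_prop
  have hzero : (0 : ℝ) = volume.real B := by
    calc (0 : ℝ) = ∫ v in B, (0 : ℝ) := by simp
      _ = ∫ v in B, ∑ i, c i * (1 + τ i • f' v).det := by simp_rw [← hpoint]
      _ = ∑ i, c i * ∫ v in B, (1 + τ i • f' v).det := by
        rw [integral_finsetSum _ fun i _ => hint i]
        simp_rw [integral_const_mul]
      _ = ∑ i, c i * volume.real B := by
        exact Finset.sum_congr rfl fun i _ => by rw [hsmall _ (hτ i).1 (hτ i).2]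
      _ = volume.real B := by rw [← Finset.sum_mul, hc, one_mul]
  have hpos : 0 < volume.real B := by
    rw [Measure.real, ENNReal.toReal_pos_iff]
    exact ⟨measure_closedBall_pos _ _ hR, measure_closedBall_lt_top⟩
  exact hpos.ne hzero

lemma exists_zero_of_bounded_displacement_inner (g : E → E) (hg : ContDiff ℝ 1 g) {M : ℝ}
    (h : ∀ v, ‖g v - v‖ ≤ M) : ∃ v, g v = 0 := by
  by_contra! hne
  have hM : 0 ≤ M := (norm_nonneg _).trans (h 0)
  let χ : ContDiffBump (0 : E) := ⟨M + 1, M + 2, by linarith, by linarith⟩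
  let g' : E → E := fun v => v + χ v • (g v - v)
  have hg' : ContDiff ℝ 1 g' := contDiff_id.add (χ.contDiff.smul (hg.sub contDiff_id))
  have hne' : ∀ v, g' v ≠ 0 := by
    intro v hv
    by_cases hvM : ‖v‖ ≤ M + 1
    · have h1 : χ v = 1 := χ.one_of_mem_closedBall (by simpa [χ] using hvM)
      simp only [g', h1, one_smul, add_sub_cancel] at hv
      exact hne v hv
    · have h1 : ‖χ v • (g v - v)‖ ≤ M := by
        rw [norm_smul, Real.norm_eq_abs, abs_of_nonneg χ.nonneg]
        calc χ v * ‖g v - v‖ ≤ 1 * ‖g v - v‖ := by gcongr; exact χ.le_one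
          _ ≤ M := by rw [one_mul]; exact h v
      have h2 : v = -(χ v • (g v - v)) := eq_neg_of_add_eq_zero_left hv
      rw [← norm_neg, ← h2] at h1
      linarith
  have hR : 0 < M + 2 := by linarith
  refine no_retraction hR (fun v => ((M + 2) * ‖g' v‖⁻¹) • g' v) ?_ ?_ ?_
  · refine ContDiff.smul (contDiff_const.mul (ContDiff.inv ?_ ?_)) hg'
    · exact hg'.norm ℝ hne'
    · intro v; exact norm_ne_zero_iff.2 (hne' v)
  · intro v
    have := norm_pos_iff.2 (hne' v)
    rw [norm_smul, norm_mul, norm_inv, norm_norm, Real.norm_eq_abs, abs_of_pos hR]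
    field_simp
  · intro v hv
    have h0 : χ v = 0 := χ.zero_of_le_dist (by simp [χ, hv])
    have : g' v = v := by simp [g', h0]
    simp only [this, hv]
    rw [mul_inv_cancel₀ hR.ne', one_smul]

/-- A `C¹` self-map of a finite-dimensional space at bounded distance from the identity has
a zero. -/
lemma exists_zero_of_bounded_displacement {W : Type*} [NormedAddCommGroup W] [NormedSpace ℝ W]
    [FiniteDimensional ℝ W] (g : W → W) (hg : ContDiff ℝ 1 g) {M : ℝ}
    (h : ∀ v, ‖g v - v‖ ≤ M) : ∃ v, g v = 0 := by
  let e := toEuclidean (E := W)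
  let eL := e.toContinuousLinearMap
  obtain ⟨v, hv⟩ := exists_zero_of_bounded_displacement_inner (fun v => e (g (e.symm v)))
    (e.contDiff.comp (hg.comp e.symm.contDiff)) (M := ‖eL‖ * M) (fun v => by
      have h1 : e (g (e.symm v)) - v = eL (g (e.symm v) - e.symm v) := by simp [eL]
      rw [h1]
      exact (eL.le_opNorm _).trans (mul_le_mul_of_nonneg_left (h _) (norm_nonneg _)))
  exact ⟨e.symm v, by simpa using hv⟩

end Brouwer

section Minmax

variable {V W : Type*} [NormedAddCommGroup V] [NormedSpace ℝ V] [FiniteDimensional ℝ V]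
  [NormedAddCommGroup W] [NormedSpace ℝ W]

/-- The upper bounds of `Φ` on `C¹` deformations of the linear subspace `range α` at bounded
distance from it. -/
def deformationBounds (α : W →L[ℝ] V) (Φ : V → ℝ) : Set ℝ :=
  {c | ∃ σ : W → V, ContDiff ℝ 1 σ ∧ (∃ M, ∀ v, ‖σ v - α v‖ ≤ M) ∧ ∀ v, Φ (σ v) ≤ c}

lemma exists_gradient_map : ∃ (J : (V →L[ℝ] ℝ) →L[ℝ] V) (a c : ℝ), 0 < a ∧ 0 < c ∧
    ∀ l, c * ‖l‖ ^ 2 ≤ l (J l) ∧ ‖J l‖ ^ 2 ≤ a * l (J l) := by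
  let e := toEuclidean (E := V)
  let eL := e.toContinuousLinearMap
  let eS := e.symm.toContinuousLinearMap
  let D := InnerProductSpace.toDual ℝ (EuclideanSpace ℝ (Fin (Module.finrank ℝ V)))
  let DS : (StrongDual ℝ (EuclideanSpace ℝ (Fin (Module.finrank ℝ V)))) →L[ℝ] _ :=
    D.symm.toContinuousLinearEquiv.toContinuousLinearMap
  let C : (V →L[ℝ] ℝ) →L[ℝ] (StrongDual ℝ (EuclideanSpace ℝ (Fin (Module.finrank ℝ V)))) :=
    (ContinuousLinearMap.compL ℝ _ V ℝ).flip eS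
  refine ⟨eS.comp (DS.comp C), ‖eS‖ ^ 2 + 1, (‖eL‖ ^ 2 + 1)⁻¹, by positivity, by positivity,
    fun l => ?_⟩
  have hval : l ((eS.comp (DS.comp C)) l) = ‖C l‖ ^ 2 := by
    have h1 : l ((eS.comp (DS.comp C)) l) = (C l) (D.symm (C l)) := rfl
    rw [h1, ← InnerProductSpace.toDual_symm_apply (𝕜 := ℝ) (y := C l)]
    simp only [D]
    rw [real_inner_self_eq_norm_sq, LinearIsometryEquiv.norm_map]
  rw [hval]
  constructor
  · have h1 : l = (C l).comp eL := by ext v; simp [C, eL, eS]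
    have h2 : ‖l‖ ≤ ‖C l‖ * ‖eL‖ := by
      conv_lhs => rw [h1]
      exact ContinuousLinearMap.opNorm_comp_le _ _
    rw [inv_mul_le_iff₀ (by positivity)]
    calc ‖l‖ ^ 2 ≤ (‖C l‖ * ‖eL‖) ^ 2 := by gcongr
      _ ≤ _ := by nlinarith [sq_nonneg ‖C l‖]
  · have h1 : ‖(eS.comp (DS.comp C)) l‖ ≤ ‖eS‖ * ‖C l‖ := by
      have : (eS.comp (DS.comp C)) l = eS (D.symm (C l)) := rfl
      rw [this]
      refine (eS.le_opNorm _).trans ?_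
      rw [LinearIsometryEquiv.norm_map]
    calc ‖(eS.comp (DS.comp C)) l‖ ^ 2 ≤ (‖eS‖ * ‖C l‖) ^ 2 := by gcongr
      _ ≤ _ := by nlinarith [sq_nonneg ‖C l‖]

/-- The minmax value over deformations of `range α` is a critical value. -/
lemma exists_critical_point_sInf (α : W →L[ℝ] V) {Φ : V → ℝ} (hΦ : ContDiff ℝ 2 Φ) {L : NNReal}
    (hL : LipschitzWith L (fderiv ℝ Φ)) {δ R : ℝ} (hδ : 0 < δ)
    (hR : ∀ z, R ≤ ‖z‖ → δ ≤ ‖fderiv ℝ Φ z‖)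
    (hne : (deformationBounds α Φ).Nonempty) (hbdd : BddBelow (deformationBounds α Φ)) :
    ∃ z, fderiv ℝ Φ z = 0 ∧ Φ z = sInf (deformationBounds α Φ) := by
  set c := sInf (deformationBounds α Φ) with hc
  by_contra! hcrit
  obtain ⟨J, a, k, ha, hk, hJ⟩ := exists_gradient_map (V := V)
  let s : V → ℝ := fun z => fderiv ℝ Φ z (J (fderiv ℝ Φ z))
  have hdΦ : ContDiff ℝ 1 (fderiv ℝ Φ) := hΦ.fderiv_right (m := 1) (by norm_num)
  have hs1 : ContDiff ℝ 1 s := hdΦ.clm_apply (J.contDiff.comp hdΦ)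
  have hs0 : ∀ z, 0 ≤ s z := fun z => le_trans (by positivity) (hJ (fderiv ℝ Φ z)).1
  let X : V → V := fun z => (1 + s z)⁻¹ • J (fderiv ℝ Φ z)
  have hX : ContDiff ℝ 1 X := by
    refine ContDiff.smul (ContDiff.inv (contDiff_const.add hs1) fun z => ?_) (J.contDiff.comp hdΦ)
    linarith [hs0 z]
  have hXn : ∀ z, ‖X z‖ ^ 2 ≤ a * (s z / (1 + s z)) := by
    intro z
    have h1 := (hJ (fderiv ℝ Φ z)).2
    have hp : 0 < 1 + s z := by linarith [hs0 z]
    rw [norm_smul, mul_pow, norm_inv, Real.norm_eq_abs, abs_of_pos hp]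
    calc ((1 + s z)⁻¹) ^ 2 * ‖J (fderiv ℝ Φ z)‖ ^ 2 ≤ ((1 + s z)⁻¹) ^ 2 * (a * s z) := by
          gcongr
      _ = a * (s z / (1 + s z)) * (1 + s z)⁻¹ := by field_simp
      _ ≤ a * (s z / (1 + s z)) * 1 := by
          have := hs0 z
          gcongr
          exact inv_le_one_of_one_le₀ (by linarith)
      _ = _ := mul_one _
  set η : ℝ := 1 / (2 * (L * a + 1)) with hη
  have hη0 : 0 < η := by positivity
  have hηL : L * η * a ≤ 1 / 2 := by
    rw [hη]
    field_simp
    linarith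
  have hdesc : ∀ z, Φ (z - η • X z) ≤ Φ z - η / 2 * (s z / (1 + s z)) := by
    intro z
    set r := ‖η • X z‖ with hr
    have hmv := (convex_closedBall z r).norm_image_sub_le_of_norm_fderiv_le' (f := Φ)
      (φ := fderiv ℝ Φ z) (C := L * r) (x := z) (y := z - η • X z) (𝕜 := ℝ)
      (fun x _ => (hΦ.differentiable two_ne_zero).differentiableAt)
      (fun x hx => by
        have := hL.dist_le_mul x z
        rw [dist_eq_norm] at this
        exact this.trans (by gcongr; exact hx))
      (mem_closedBall_self (norm_nonneg _)) (by simp [hr])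
    have h1 : z - η • X z - z = -(η • X z) := by abel
    rw [h1, norm_neg, map_neg, map_smul] at hmv
    have h2 : fderiv ℝ Φ z (X z) = s z / (1 + s z) := by
      simp only [X, map_smul, smul_eq_mul, s]
      rw [inv_mul_eq_div]
    rw [h2, Real.norm_eq_abs] at hmv
    have h3 := (abs_le.1 hmv).2
    have h4 : L * r * ‖η • X z‖ = L * η ^ 2 * ‖X z‖ ^ 2 := by
      rw [hr, norm_smul, Real.norm_eq_abs, abs_of_pos hη0]; ring
    have h5 : L * η ^ 2 * ‖X z‖ ^ 2 ≤ (L * η * a) * η * (s z / (1 + s z)) := by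
      calc L * η ^ 2 * ‖X z‖ ^ 2 ≤ L * η ^ 2 * (a * (s z / (1 + s z))) := by
            gcongr; exact hXn z
        _ = _ := by ring
    have h6 : (L * η * a) * η * (s z / (1 + s z)) ≤ 1 / 2 * η * (s z / (1 + s z)) := by
      have := hs0 z
      gcongr
    simp only [smul_eq_mul] at h3
    rw [h4] at h3
    linarith
  -- a lower bound for the slope near the level `c`
  obtain ⟨s₀, hs₀, μ, hμ, hslope⟩ : ∃ s₀ > 0, ∃ μ > 0, ∀ z, |Φ z - c| < μ → s₀ ≤ s z := by
    have hsout : ∀ z, R ≤ ‖z‖ → k * δ ^ 2 ≤ s z := fun z hz =>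
      le_trans (by have := hR z hz; gcongr) (hJ (fderiv ℝ Φ z)).1
    have hcont : Continuous fun z => max |Φ z - c| (s z) :=
      ((hΦ.continuous.sub continuous_const).abs).max hs1.continuous
    have hposm : ∀ z, 0 < max |Φ z - c| (s z) := by
      intro z
      by_cases hz : fderiv ℝ Φ z = 0
      · exact lt_max_of_lt_left (abs_pos.2 (sub_ne_zero.2 (hcrit z hz)))
      · refine lt_max_of_lt_right (lt_of_lt_of_le ?_ (hJ (fderiv ℝ Φ z)).1)
        have := norm_pos_iff.2 hz
        positivity
    by_cases hR0 : 0 ≤ R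
    · obtain ⟨z₀, -, hz₀⟩ := (isCompact_closedBall (0 : V) R).exists_isMinOn
        ⟨0, by simpa using hR0⟩ hcont.continuousOn
      refine ⟨min (k * δ ^ 2) (max |Φ z₀ - c| (s z₀)), lt_min (by positivity) (hposm z₀),
        max |Φ z₀ - c| (s z₀), hposm z₀, fun z hz => ?_⟩
      rcases le_total R ‖z‖ with h | h
      · exact (min_le_left _ _).trans (hsout z h)
      · refine (min_le_right _ _).trans ?_
        have h1 : max |Φ z₀ - c| (s z₀) ≤ max |Φ z - c| (s z) := hz₀ (by simpa using h)
        rcases le_max_iff.1 h1 with h2 | h2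
        · exact absurd hz (not_lt.2 h2)
        · exact h2
    · exact ⟨k * δ ^ 2, by positivity, 1, one_pos, fun z _ =>
        hsout z ((not_le.1 hR0).le.trans (norm_nonneg _))⟩
  set κ := η / 2 * (s₀ / (1 + s₀)) with hκ
  have hκ0 : 0 < κ := by positivity
  obtain ⟨c', ⟨σ, hσ, ⟨M, hM⟩, hc'⟩, hlt⟩ := exists_lt_of_csInf_lt hne
    (show sInf (deformationBounds α Φ) < c + min μ (κ / 2) from
      lt_add_of_pos_right _ (lt_min hμ (by positivity)))
  have hmem : max (c - μ) (c' - κ) ∈ deformationBounds α Φ := by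
    refine ⟨fun v => σ v - η • X (σ v), hσ.sub (contDiff_const.smul (hX.comp hσ)),
      ⟨M + η * (a + 1), fun v => ?_⟩, fun v => ?_⟩
    · have h1 : ‖X (σ v)‖ ≤ a + 1 := by
        have h2 := hXn (σ v)
        have h3 : s (σ v) / (1 + s (σ v)) ≤ 1 :=
          (div_le_one (by linarith [hs0 (σ v)])).2 (by linarith)
        nlinarith [norm_nonneg (X (σ v))]
      calc ‖σ v - η • X (σ v) - α v‖ = ‖(σ v - α v) - η • X (σ v)‖ := by congr 1; abel
        _ ≤ ‖σ v - α v‖ + ‖η • X (σ v)‖ := norm_sub_le _ _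
        _ ≤ M + η * (a + 1) := by
          rw [norm_smul, Real.norm_eq_abs, abs_of_pos hη0]
          gcongr
          exact hM v
    · have hd := hdesc (σ v)
      have hq : 0 ≤ s (σ v) / (1 + s (σ v)) := by have := hs0 (σ v); positivity
      have hcv := hc' v
      have hmin1 := min_le_left μ (κ / 2)
      by_cases h : |Φ (σ v) - c| < μ
      · have h1 := hslope _ h
        have h2 : s₀ / (1 + s₀) ≤ s (σ v) / (1 + s (σ v)) := by
          rw [div_le_div_iff₀ (by linarith) (by linarith)]
          nlinarith
        have h3 : κ ≤ η / 2 * (s (σ v) / (1 + s (σ v))) := by rw [hκ]; gcongr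
        exact le_max_of_le_right (by linarith)
      · refine le_max_of_le_left ?_
        have : Φ (σ v) ≤ c - μ := by
          by_contra hcon
          exact h (abs_lt.2 ⟨by linarith, by linarith⟩)
        have : 0 ≤ η / 2 * (s (σ v) / (1 + s (σ v))) := by positivity
        linarith
  have hle := csInf_le hbdd hmem
  rw [← hc] at hle
  rcases le_max_iff.1 hle with h | h
  · linarith
  · have := min_le_right μ (κ / 2)
    linarith

omit [FiniteDimensional ℝ V] in
/-- Linking: if `Φ` is bounded below on the kernel of a left inverse of `α`, then the minmax is
finite. -/
lemma bddBelow_deformationBounds [FiniteDimensional ℝ W] (α : W →L[ℝ] V) (β : V →L[ℝ] W)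
    (hβ : ∀ v, β (α v) = v) {Φ : V → ℝ} {m : ℝ} (hm : ∀ z, β z = 0 → m ≤ Φ z) :
    BddBelow (deformationBounds α Φ) := by
  refine ⟨m, ?_⟩
  rintro c ⟨σ, hσ, ⟨M, hM⟩, hc⟩
  obtain ⟨v, hv⟩ := exists_zero_of_bounded_displacement (fun v => β (σ v)) (β.contDiff.comp hσ)
    (M := ‖β‖ * M) (fun v => by
      have : β (σ v) - v = β (σ v - α v) := by rw [map_sub, hβ]
      rw [this]
      exact (β.le_opNorm _).trans (mul_le_mul_of_nonneg_left (hM v) (norm_nonneg _)))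
  exact (hm _ hv).trans (hc v)

end Minmax

section Pairing

variable {W : Type*} [NormedAddCommGroup W] [NormedSpace ℝ W] [FiniteDimensional ℝ W]
  {B : W →L[ℝ] W →L[ℝ] ℝ}

lemma exists_norm_le_deriv₂ (hB : ∀ w, ‖w‖ ^ 2 ≤ B w w) : ∃ K > 0, ∀ z, ‖z‖ ≤ K * ‖B.deriv₂ z‖ := by
  obtain ⟨K, hK, h⟩ := LinearMap.exists_antilipschitzWith
    (B.deriv₂ : (W × W) →ₗ[ℝ]
      ((W × W) →L[ℝ] ℝ)) (by
      rw [LinearMap.ker_eq_bot']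
      intro z hz
      have h1 := congrArg (fun L : (W × W) →L[ℝ] ℝ => L (z.2, z.1)) hz
      simp only [ContinuousLinearMap.coe_coe, ContinuousLinearMap.coe_deriv₂,
        zero_apply] at h1
      have h2 := hB z.1
      have h3 := hB z.2
      have h4 : ‖z.1‖ = 0 := by nlinarith [norm_nonneg z.1, norm_nonneg z.2]
      have h5 : ‖z.2‖ = 0 := by nlinarith [norm_nonneg z.1, norm_nonneg z.2]
      exact Prod.ext (norm_eq_zero.1 h4) (norm_eq_zero.1 h5))
  exact ⟨K, hK, fun z => by simpa using h.le_mul_dist z 0⟩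

/-- Comparable perturbations of a coercive bilinear pairing have comparable critical values. -/
lemma exists_critical_points_le (hB : ∀ w, ‖w‖ ^ 2 ≤ B w w) {G₀ G₁ : W × W → ℝ}
    (h₀ : ContDiff ℝ 2 G₀) (h₁ : ContDiff ℝ 2 G₁) {L₀ L₁ : NNReal}
    (hL₀ : LipschitzWith L₀ (fderiv ℝ G₀)) (hL₁ : LipschitzWith L₁ (fderiv ℝ G₁))
    {M₀ M₁ : ℝ} (hM₀ : ∀ z, ‖fderiv ℝ G₀ z‖ ≤ M₀) (hM₁ : ∀ z, ‖fderiv ℝ G₁ z‖ ≤ M₁)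
    (hle : ∀ z, G₀ z ≤ G₁ z) :
    ∃ z₀ z₁, B.deriv₂ z₀ + fderiv ℝ G₀ z₀ = 0 ∧
      B.deriv₂ z₁ + fderiv ℝ G₁ z₁ = 0 ∧
      B z₀.1 z₀.2 + G₀ z₀ ≤ B z₁.1 z₁.2 + G₁ z₁ := by
  let α : W →L[ℝ] W × W :=
    (ContinuousLinearMap.id ℝ W).prod (-(ContinuousLinearMap.id ℝ W))
  let β : W × W →L[ℝ] W :=
    (1 / 2 : ℝ) • (ContinuousLinearMap.fst ℝ W W - ContinuousLinearMap.snd ℝ W W)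
  have hβ : ∀ v, β (α v) = v := by
    intro v
    change (1 / 2 : ℝ) • (v - -v) = v
    rw [sub_neg_eq_add, ← two_smul ℝ v, smul_smul]
    norm_num
  obtain ⟨K, hK, hKz⟩ := exists_norm_le_deriv₂ hB
  have key : ∀ {G : W × W → ℝ} {L : NNReal} {M : ℝ}, ContDiff ℝ 2 G → LipschitzWith L (fderiv ℝ G) →
      (∀ z, ‖fderiv ℝ G z‖ ≤ M) →
      (deformationBounds α (fun z => B z.1 z.2 + G z)).Nonempty ∧
      BddBelow (deformationBounds α (fun z => B z.1 z.2 + G z)) ∧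
      ∃ z, B.deriv₂ z + fderiv ℝ G z = 0 ∧ B z.1 z.2 + G z =
        sInf (deformationBounds α (fun z => B z.1 z.2 + G z)) := by
    intro G L M hG hL hM
    have hGn : ∀ z, ‖G z - G 0‖ ≤ M * ‖z‖ := by
      intro z
      simpa using convex_univ.norm_image_sub_le_of_norm_fderiv_le (𝕜 := ℝ) (f := G) (x := 0) (y := z)
        (fun x _ => (hG.differentiable two_ne_zero).differentiableAt) (fun x _ => hM x)
        (mem_univ _) (mem_univ _)
    have hM0 : 0 ≤ M := (norm_nonneg (fderiv ℝ G 0)).trans (hM 0)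
    have hfd : ∀ z, fderiv ℝ (fun z : W × W => B z.1 z.2 + G z) z =
        B.deriv₂ z + fderiv ℝ G z := fun z =>
      ((B.isBoundedBilinearMap.hasFDerivAt z).add (hG.differentiable two_ne_zero z).hasFDerivAt).fderiv
    have hne : (deformationBounds α (fun z => B z.1 z.2 + G z)).Nonempty := by
      refine ⟨|G 0| + M ^ 2, α, α.contDiff, ⟨0, by simp⟩, fun v => ?_⟩
      have h1 : B (α v).1 (α v).2 = - B v v := by simp [α]
      have h2 := hB v
      have h3 := hGn (α v)
      have h4 : ‖α v‖ = ‖v‖ := by simp [α, Prod.norm_def]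
      rw [h4, Real.norm_eq_abs] at h3
      have h5 := (abs_le.1 h3).2
      have h6 := le_abs_self (G 0)
      simp only [h1]
      nlinarith [sq_nonneg (‖v‖ - M), norm_nonneg v]
    have hbd : BddBelow (deformationBounds α (fun z => B z.1 z.2 + G z)) := by
      refine bddBelow_deformationBounds α β hβ (m := -|G 0| - M ^ 2) fun z hz => ?_
      have h0 : z.1 = z.2 := by
        have : (1 / 2 : ℝ) • (z.1 - z.2) = 0 := hz
        simpa [sub_eq_zero] using this
      have h2 := hB z.2
      have h3 := hGn z
      have h4 : ‖z‖ = ‖z.2‖ := by rw [Prod.norm_def, h0, max_self]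
      rw [h4, Real.norm_eq_abs] at h3
      have h5 := (abs_le.1 h3).1
      have h6 := neg_abs_le (G 0)
      rw [h0]
      nlinarith [sq_nonneg (‖z.2‖ - M), norm_nonneg z.2]
    refine ⟨hne, hbd, ?_⟩
    obtain ⟨z, hz, hzv⟩ := exists_critical_point_sInf α
      (Φ := fun z => B z.1 z.2 + G z) (B.isBoundedBilinearMap.contDiff.add hG)
      (L := ‖B.deriv₂‖₊ + L) (by
        have : fderiv ℝ (fun z : W × W => B z.1 z.2 + G z) =
          fun z => B.deriv₂ z + fderiv ℝ G z := funext hfd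
        rw [this]
        exact (B.deriv₂.lipschitz).add hL) one_pos (R := K * (M + 1)) (by
        intro z hz
        rw [hfd]
        have h1 := hKz z
        have h2 : M + 1 ≤ ‖B.deriv₂ z‖ := le_of_mul_le_mul_left (hz.trans h1) hK
        have h3 := norm_sub_le (B.deriv₂ z + fderiv ℝ G z) (fderiv ℝ G z)
        rw [add_sub_cancel_right] at h3
        linarith [hM z]) hne hbd
    exact ⟨z, by rw [← hfd]; exact hz, hzv⟩
  obtain ⟨-, hb0, z₀, hz₀, hv₀⟩ := key h₀ hL₀ hM₀
  obtain ⟨hn1, -, z₁, hz₁, hv₁⟩ := key h₁ hL₁ hM₁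
  refine ⟨z₀, z₁, hz₀, hz₁, ?_⟩
  rw [hv₀, hv₁]
  refine csInf_le_csInf hb0 hn1 ?_
  rintro c ⟨σ, hσ, hM, hc⟩
  exact ⟨σ, hσ, hM, fun v => le_trans (by simpa using hle _) (hc v)⟩

end Pairing

section AffineSum

variable {V X : Type*} [NormedAddCommGroup V] [NormedSpace ℝ V] [NormedAddCommGroup X]
  [NormedSpace ℝ X] {f : ℕ → X → ℝ}

lemma hasFDerivAt_sum_comp_affine (hf : ∀ i, ContDiff ℝ 2 (f i)) (A : ℕ → V →L[ℝ] X) (a : X)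
    (s : Finset ℕ) (z : V) : HasFDerivAt (fun z => ∑ i ∈ s, f i (a + A i z))
      (∑ i ∈ s, (fderiv ℝ (f i) (a + A i z)).comp (A i)) z :=
  HasFDerivAt.fun_sum fun i _ => (((hf i).differentiable two_ne_zero _).hasFDerivAt).comp z
    ((A i).hasFDerivAt.const_add a)

lemma exists_lipschitzWith_sum_fderiv_comp (hf : ∀ i, ContDiff ℝ 2 (f i))
    (hfc : ∀ i, HasCompactSupport (f i)) (A : ℕ → V →L[ℝ] X) (a : X) (s : Finset ℕ) :
    ∃ L, LipschitzWith L fun z => ∑ i ∈ s, (fderiv ℝ (f i) (a + A i z)).comp (A i) := by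
  induction s using Finset.induction_on with
  | empty => exact ⟨0, by simp⟩
  | insert i s hi ih =>
    obtain ⟨L, hL⟩ := ih
    obtain ⟨K, hK⟩ := ((hf i).fderiv_right (m := 1) (by norm_num)).lipschitzWith_of_hasCompactSupport
      ((hfc i).fderiv ℝ) one_ne_zero
    have h2 : LipschitzWith (K * ‖A i‖₊ * ‖A i‖₊)
        fun z => (fderiv ℝ (f i) (a + A i z)).comp (A i) := by
      refine LipschitzWith.of_dist_le_mul fun z w => ?_
      have h3 := hK.dist_le_mul (a + A i z) (a + A i w)
      rw [dist_add_left] at h3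
      have h4 := (A i).lipschitz.dist_le_mul z w
      rw [dist_eq_norm, ← ContinuousLinearMap.sub_comp]
      refine (ContinuousLinearMap.opNorm_comp_le _ _).trans ?_
      rw [← dist_eq_norm]
      calc _ ≤ (K * (‖A i‖₊ * dist z w)) * ‖A i‖ := by
            gcongr
            exact h3.trans (by gcongr)
        _ = _ := by push_cast; ring
    exact ⟨_, by simpa only [Finset.sum_insert hi] using h2.add hL⟩

lemma exists_norm_sum_fderiv_comp_le (hf : ∀ i, ContDiff ℝ 2 (f i))
    (hfc : ∀ i, HasCompactSupport (f i)) (A : ℕ → V →L[ℝ] X) (a : X) (s : Finset ℕ) :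
    ∃ M, ∀ z, ‖∑ i ∈ s, (fderiv ℝ (f i) (a + A i z)).comp (A i)‖ ≤ M := by
  have h1 : ∀ i, ∃ M, ∀ z, ‖fderiv ℝ (f i) z‖ ≤ M := fun i =>
    ((hfc i).fderiv ℝ).exists_bound_of_continuous ((hf i).continuous_fderiv two_ne_zero)
  choose M hM using h1
  refine ⟨∑ i ∈ s, M i * ‖A i‖, fun z => ?_⟩
  refine (norm_sum_le _ _).trans (Finset.sum_le_sum fun i _ => ?_)
  exact (ContinuousLinearMap.opNorm_comp_le _ _).trans (by gcongr; exact hM i _)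

end AffineSum

section Action

variable {E : Type*} [NormedAddCommGroup E] [InnerProductSpace ℝ E] [FiniteDimensional ℝ E]

/-- Gradient of a function on `E × E` with respect to the first variable. -/
def gradFst (f : E × E → ℝ) (z : E × E) : E :=
  (InnerProductSpace.toDual ℝ E).symm ((fderiv ℝ f z).comp (ContinuousLinearMap.inl ℝ E E))

/-- Gradient of a function on `E × E` with respect to the second variable. -/
def gradSnd (f : E × E → ℝ) (z : E × E) : E :=
  (InnerProductSpace.toDual ℝ E).symm ((fderiv ℝ f z).comp (ContinuousLinearMap.inr ℝ E E))

lemma inner_gradFst (f : E × E → ℝ) (z : E × E) (v : E) :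
    ⟪gradFst f z, v⟫ = fderiv ℝ f z (v, 0) := by
  rw [gradFst, InnerProductSpace.toDual_symm_apply]; rfl

lemma inner_gradSnd (f : E × E → ℝ) (z : E × E) (v : E) :
    ⟪gradSnd f z, v⟫ = fderiv ℝ f z (0, v) := by
  rw [gradSnd, InnerProductSpace.toDual_symm_apply]; rfl

lemma fderiv_eq_inner_grad (f : E × E → ℝ) (z v : E × E) :
    fderiv ℝ f z v = ⟪gradFst f z, v.1⟫ + ⟪gradSnd f z, v.2⟫ := by
  rw [inner_gradFst, inner_gradSnd, ← map_add]; simp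

/-- The pairing `∑ ⟪y i, p i⟫`. -/
def pairing (E : Type*) [NormedAddCommGroup E] [InnerProductSpace ℝ E] (n : ℕ) :
    (Fin n → E) →L[ℝ] (Fin n → E) →L[ℝ] ℝ :=
  ∑ i, (innerSL ℝ).bilinearComp (ContinuousLinearMap.proj i) (ContinuousLinearMap.proj i)

omit [FiniteDimensional ℝ E] in
lemma pairing_apply {n : ℕ} (y p : Fin n → E) : pairing E n y p = ∑ i, ⟪y i, p i⟫ := by
  simp [pairing]

omit [FiniteDimensional ℝ E] in
lemma norm_sq_le_pairing_self {n : ℕ} (y : Fin n → E) : ‖y‖ ^ 2 ≤ pairing E n y y := by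
  rw [pairing_apply]
  simp only [real_inner_self_eq_norm_sq]
  have hnn : 0 ≤ ∑ i, ‖y i‖ ^ 2 := Finset.sum_nonneg fun _ _ => by positivity
  have h : ‖y‖ ≤ √(∑ i, ‖y i‖ ^ 2) := by
    refine (pi_norm_le_iff_of_nonneg (Real.sqrt_nonneg _)).2 fun i => ?_
    exact Real.le_sqrt_of_sq_le
      (Finset.single_le_sum (f := fun i => ‖y i‖ ^ 2) (fun _ _ => by positivity)
        (Finset.mem_univ i))
  calc ‖y‖ ^ 2 ≤ (√(∑ i, ‖y i‖ ^ 2)) ^ 2 := by gcongr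
    _ = _ := Real.sq_sqrt hnn

/-- A discrete Hamiltonian trajectory from a point of the fibre over `x₀` to the covector `q`. -/
structure IsDiscreteOrbit (f : ℕ → E × E → ℝ) (n : ℕ) (x₀ q : E) (xs ps : ℕ → E) : Prop where
  start : xs 0 = x₀
  finish : ps n = q
  step_fst : ∀ i < n, xs (i + 1) = xs i + gradSnd (f i) (xs i, ps (i + 1))
  step_snd : ∀ i < n, ps i = ps (i + 1) + gradFst (f i) (xs i, ps (i + 1))

/-- Evaluation at `k`, extended by zero. -/
def evalAt (E : Type*) [NormedAddCommGroup E] [InnerProductSpace ℝ E] (n k : ℕ) :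
    (Fin n → E) →L[ℝ] E :=
  if h : k < n then ContinuousLinearMap.proj ⟨k, h⟩ else 0

omit [FiniteDimensional ℝ E] in
lemma evalAt_of_lt {n k : ℕ} (h : k < n) (y : Fin n → E) : evalAt E n k y = y ⟨k, h⟩ := by
  simp [evalAt, h]

omit [FiniteDimensional ℝ E] in
lemma evalAt_single {n : ℕ} (k : ℕ) (j : Fin n) (u : E) :
    evalAt E n k (Pi.single j u) = if k = j then u else 0 := by
  by_cases h : k < n
  · rw [evalAt_of_lt h]
    by_cases hj : k = j
    · have : (⟨k, h⟩ : Fin n) = j := Fin.ext hj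
      rw [this, if_pos hj, Pi.single_eq_same]
    · have : (⟨k, h⟩ : Fin n) ≠ j := fun hh => hj (congrArg Fin.val hh)
      rw [if_neg hj, Pi.single_eq_of_ne this]
  · have : k ≠ j := fun hh => h (hh ▸ j.2)
    simp [evalAt, h, this]

/-- The linear part of `(y, p) ↦ (x i, p i)`, where `x i = x₀ - ∑ k < i, y k`. -/
def nodeAt (E : Type*) [NormedAddCommGroup E] [InnerProductSpace ℝ E] (n i : ℕ) :
    (Fin n → E) × (Fin n → E) →L[ℝ] E × E :=
  ((-∑ k ∈ Finset.range i, evalAt E n k).comp (ContinuousLinearMap.fst ℝ _ _)).prod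
    ((evalAt E n i).comp (ContinuousLinearMap.snd ℝ _ _))

omit [FiniteDimensional ℝ E] in
lemma nodeAt_apply {n : ℕ} (i : ℕ) (z : (Fin n → E) × (Fin n → E)) :
    nodeAt E n i z = (-∑ k ∈ Finset.range i, evalAt E n k z.1, evalAt E n i z.2) := by
  simp [nodeAt]

/-- The non-quadratic part of the discrete action. -/
def genFun (f : ℕ → E × E → ℝ) (n : ℕ) (x₀ q : E) (z : (Fin n → E) × (Fin n → E)) : ℝ :=
  ⟪q, x₀ + (nodeAt E n n z).1⟫ + ∑ i ∈ Finset.range n, f i ((x₀, 0) + nodeAt E n i z)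

omit [FiniteDimensional ℝ E] in
lemma hasFDerivAt_genFun {f : ℕ → E × E → ℝ} (hf : ∀ i, ContDiff ℝ 2 (f i)) (n : ℕ) (x₀ q : E)
    (z : (Fin n → E) × (Fin n → E)) :
    HasFDerivAt (genFun f n x₀ q)
      ((innerSL ℝ q).comp ((ContinuousLinearMap.fst ℝ E E).comp (nodeAt E n n)) +
        ∑ i ∈ Finset.range n,
          (fderiv ℝ (f i) ((x₀, 0) + nodeAt E n i z)).comp (nodeAt E n i)) z := by
  refine HasFDerivAt.add ?_ (hasFDerivAt_sum_comp_affine hf _ _ _ z)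
  exact (innerSL ℝ q).hasFDerivAt.comp z
    (((ContinuousLinearMap.fst ℝ E E).comp (nodeAt E n n)).hasFDerivAt.const_add x₀)

omit [FiniteDimensional ℝ E] in
lemma contDiff_genFun {f : ℕ → E × E → ℝ} (hf : ∀ i, ContDiff ℝ 2 (f i)) (n : ℕ) (x₀ q : E) :
    ContDiff ℝ 2 (genFun f n x₀ q) := by
  refine ContDiff.add ?_ (ContDiff.sum fun i _ => ?_)
  · exact contDiff_const.inner ℝ (contDiff_const.add
      ((ContinuousLinearMap.fst ℝ E E).comp (nodeAt E n n)).contDiff)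
  · exact (hf i).comp (contDiff_const.add (nodeAt E n i).contDiff)

omit [FiniteDimensional ℝ E] in
lemma exists_lipschitzWith_fderiv_genFun {f : ℕ → E × E → ℝ} (hf : ∀ i, ContDiff ℝ 2 (f i))
    (hfc : ∀ i, HasCompactSupport (f i)) (n : ℕ) (x₀ q : E) :
    ∃ L, LipschitzWith L (fderiv ℝ (genFun f n x₀ q)) := by
  obtain ⟨L, hL⟩ := exists_lipschitzWith_sum_fderiv_comp hf hfc (nodeAt E n) (x₀, 0)
    (Finset.range n)
  refine ⟨L, LipschitzWith.of_dist_le_mul fun z w => ?_⟩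
  rw [(hasFDerivAt_genFun hf n x₀ q z).fderiv, (hasFDerivAt_genFun hf n x₀ q w).fderiv,
    dist_add_left]
  exact hL.dist_le_mul z w

omit [FiniteDimensional ℝ E] in
lemma exists_norm_fderiv_genFun_le {f : ℕ → E × E → ℝ} (hf : ∀ i, ContDiff ℝ 2 (f i))
    (hfc : ∀ i, HasCompactSupport (f i)) (n : ℕ) (x₀ q : E) :
    ∃ M, ∀ z, ‖fderiv ℝ (genFun f n x₀ q) z‖ ≤ M := by
  obtain ⟨M, hM⟩ := exists_norm_sum_fderiv_comp_le hf hfc (nodeAt E n) (x₀, 0) (Finset.range n)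
  refine ⟨‖(innerSL ℝ q).comp ((ContinuousLinearMap.fst ℝ E E).comp (nodeAt E n n))‖ + M,
    fun z => ?_⟩
  rw [(hasFDerivAt_genFun hf n x₀ q z).fderiv]
  exact norm_add_le_of_le le_rfl (hM z)

lemma exists_isDiscreteOrbit {f : ℕ → E × E → ℝ} (hf : ∀ i, ContDiff ℝ 2 (f i)) {n : ℕ}
    {x₀ q : E} {z : (Fin n → E) × (Fin n → E)}
    (hz : (pairing E n).deriv₂ z + fderiv ℝ (genFun f n x₀ q) z = 0) :
    ∃ xs ps, IsDiscreteOrbit f n x₀ q xs ps ∧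
      pairing E n z.1 z.2 + genFun f n x₀ q z = ⟪q, xs n⟫ + ∑ i ∈ Finset.range n,
        (f i (xs i, ps (i + 1)) - ⟪ps (i + 1), gradSnd (f i) (xs i, ps (i + 1))⟫) := by
  let xs : ℕ → E := fun i => x₀ - ∑ k ∈ Finset.range i, evalAt E n k z.1
  let node : ℕ → E × E := fun i => (xs i, evalAt E n i z.2)
  have hnode : ∀ i, (x₀, (0 : E)) + nodeAt E n i z = node i := fun i => by
    rw [nodeAt_apply]
    simp [node, xs, sub_eq_add_neg]
  let ps : ℕ → E := fun i => q + ∑ k ∈ Finset.Ico i n, gradFst (f k) (node k)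
  have hcrit : ∀ w : (Fin n → E) × (Fin n → E),
      ∑ i, ⟪z.1 i, w.2 i⟫ + ∑ i, ⟪w.1 i, z.2 i⟫ +
        (-∑ k ∈ Finset.range n, ⟪q, evalAt E n k w.1⟫ + ∑ i ∈ Finset.range n,
          (-∑ k ∈ Finset.range i, ⟪gradFst (f i) (node i), evalAt E n k w.1⟫ +
            ⟪gradSnd (f i) (node i), evalAt E n i w.2⟫)) = 0 := by
    intro w
    have h := congrArg (fun L : ((Fin n → E) × (Fin n → E)) →L[ℝ] ℝ => L w) hz
    rw [(hasFDerivAt_genFun hf n x₀ q z).fderiv] at h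
    simp only [hnode] at h
    simpa [nodeAt_apply, fderiv_eq_inner_grad, pairing_apply, inner_sum] using h
  have hy : ∀ j : Fin n, z.1 j = - gradSnd (f j) (node j) := by
    intro j
    refine ext_inner_right ℝ fun u => ?_
    have h := hcrit (0, Pi.single j u)
    have h1 : ∑ i, ⟪z.1 i, (Pi.single j u : Fin n → E) i⟫ = ⟪z.1 j, u⟫ := by
      rw [Finset.sum_eq_single j] <;> simp +contextual
    simp only [evalAt_single] at h
    rw [h1] at h
    simp [apply_ite, j.2] at h
    rw [inner_neg_left]
    linarith
  have hp : ∀ j : Fin n, z.2 j = q + ∑ k ∈ Finset.Ico (j + 1 : ℕ) n, gradFst (f k) (node k) := by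
    intro j
    refine ext_inner_right ℝ fun u => ?_
    have h := hcrit (Pi.single j u, 0)
    have h1 : ∑ i, ⟪(Pi.single j u : Fin n → E) i, z.2 i⟫ = ⟪z.2 j, u⟫ := by
      rw [Finset.sum_eq_single j, Pi.single_eq_same, real_inner_comm]
      · intro b _ hb
        rw [Pi.single_eq_of_ne hb, inner_zero_left]
      · simp
    simp only [evalAt_single] at h
    rw [h1] at h
    simp [apply_ite, j.2] at h
    rw [inner_add_left, sum_inner]
    have h2 : ∑ k ∈ Finset.Ico (j + 1 : ℕ) n, ⟪gradFst (f k) (node k), u⟫ =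
        ∑ k ∈ Finset.range n, if (j : ℕ) < k then ⟪gradFst (f k) (node k), u⟫ else 0 := by
      rw [← Finset.sum_filter]
      refine Finset.sum_congr ?_ fun _ _ => rfl
      ext k
      simp
      omega
    have h3 : (∑ k ∈ Finset.range n, if (j : ℕ) < k then -⟪gradFst (f k) (node k), u⟫ else 0) =
        -∑ k ∈ Finset.range n, if (j : ℕ) < k then ⟪gradFst (f k) (node k), u⟫ else 0 := by
      rw [← Finset.sum_neg_distrib]
      exact Finset.sum_congr rfl fun k _ => by split_ifs <;> simp
    rw [h2]
    linarith
  have hps : ∀ i (h : i < n), ps (i + 1) = evalAt E n i z.2 := fun i h => by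
    rw [evalAt_of_lt h, hp]
  refine ⟨xs, ps, ⟨by simp [xs], by simp [ps], fun i h => ?_, fun i h => ?_⟩, ?_⟩
  · rw [hps i h]
    have := hy ⟨i, h⟩
    simp only [xs, Finset.sum_range_succ, evalAt_of_lt h, this, node]
    abel
  · rw [hps i h]
    change _ = _ + gradFst (f i) (node i)
    rw [← hps i h]
    simp only [ps]
    rw [← Finset.sum_Ioo_add_eq_sum_Ico h, add_assoc]
    rfl
  · have h1 : ∑ i, ⟪z.1 i, z.2 i⟫ =
        - ∑ i ∈ Finset.range n, ⟪evalAt E n i z.2, gradSnd (f i) (node i)⟫ := by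
      rw [Finset.sum_range, ← Finset.sum_neg_distrib]
      refine Finset.sum_congr rfl fun i _ => ?_
      rw [hy, evalAt_of_lt i.2, inner_neg_left, real_inner_comm]
    rw [pairing_apply, genFun, h1, nodeAt_apply, Finset.sum_sub_distrib]
    have h2 : ∀ i ∈ Finset.range n, f i (xs i, ps (i + 1)) = f i (node i) := fun i hi => by
      rw [hps i (Finset.mem_range.1 hi)]
    have h3 : ∀ i ∈ Finset.range n, ⟪ps (i + 1), gradSnd (f i) (xs i, ps (i + 1))⟫ =
        ⟪evalAt E n i z.2, gradSnd (f i) (node i)⟫ := fun i hi => by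
      rw [hps i (Finset.mem_range.1 hi)]
    rw [Finset.sum_congr rfl h2, Finset.sum_congr rfl h3]
    simp only [hnode, xs, ← sub_eq_add_neg]
    ring

/-- Comparable discrete Hamiltonians have trajectories with comparable actions. -/
lemma exists_isDiscreteOrbit_le {f g : ℕ → E × E → ℝ} (hf : ∀ i, ContDiff ℝ 2 (f i))
    (hfc : ∀ i, HasCompactSupport (f i)) (hg : ∀ i, ContDiff ℝ 2 (g i))
    (hgc : ∀ i, HasCompactSupport (g i)) (hle : ∀ i z, f i z ≤ g i z) (n : ℕ) (x₀ q : E) :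
    ∃ xs ps xs' ps', IsDiscreteOrbit f n x₀ q xs ps ∧ IsDiscreteOrbit g n x₀ q xs' ps' ∧
      ⟪q, xs n⟫ + ∑ i ∈ Finset.range n,
        (f i (xs i, ps (i + 1)) - ⟪ps (i + 1), gradSnd (f i) (xs i, ps (i + 1))⟫) ≤
      ⟪q, xs' n⟫ + ∑ i ∈ Finset.range n,
        (g i (xs' i, ps' (i + 1)) - ⟪ps' (i + 1), gradSnd (g i) (xs' i, ps' (i + 1))⟫) := by
  obtain ⟨L₀, hL₀⟩ := exists_lipschitzWith_fderiv_genFun hf hfc n x₀ q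
  obtain ⟨L₁, hL₁⟩ := exists_lipschitzWith_fderiv_genFun hg hgc n x₀ q
  obtain ⟨M₀, hM₀⟩ := exists_norm_fderiv_genFun_le hf hfc n x₀ q
  obtain ⟨M₁, hM₁⟩ := exists_norm_fderiv_genFun_le hg hgc n x₀ q
  obtain ⟨z₀, z₁, h₀, h₁, h⟩ := exists_critical_points_le (norm_sq_le_pairing_self (E := E) (n := n))
    (contDiff_genFun hf n x₀ q) (contDiff_genFun hg n x₀ q) hL₀ hL₁ hM₀ hM₁
    fun z => add_le_add_right (Finset.sum_le_sum fun i _ => hle i _) _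
  obtain ⟨xs, ps, ho, hv⟩ := exists_isDiscreteOrbit hf h₀
  obtain ⟨xs', ps', ho', hv'⟩ := exists_isDiscreteOrbit hg h₁
  exact ⟨xs, ps, xs', ps', ho, ho', by rw [← hv, ← hv']; exact h⟩

end Action

open scoped Topology

section Cone

variable {E : Type*} [NormedAddCommGroup E] [InnerProductSpace ℝ E]

/-- A vector which is symplectically orthogonal to a Lagrangian subspace lies in it. -/
lemma exists_eq_of_symplectic_orthogonal [FiniteDimensional ℝ E] {A B : E →ₗ[ℝ] E}
    (hsymm : ∀ v w, ⟪A v, B w⟫ = ⟪A w, B v⟫) (hinj : ∀ v, A v = 0 → B v = 0 → v = 0)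
    {a b : E} (hab : ∀ w, ⟪a, B w⟫ = ⟪b, A w⟫) : ∃ v, A v = a ∧ B v = b := by
  let R : E × E →ₗ[ℝ] E × E := (A.coprod B).prod (B.coprod (-A))
  have hR : ∀ v, R v = (A v.1 + B v.2, B v.1 - A v.2) := fun v => by
    simp [R, sub_eq_add_neg]
  have hRinj : Function.Injective R := by
    rw [← LinearMap.ker_eq_bot, LinearMap.ker_eq_bot']
    intro v hv
    rw [hR, Prod.mk_eq_zero] at hv
    have h1 : ‖A v.1 + B v.2‖ ^ 2 + ‖B v.1 - A v.2‖ ^ 2 = 0 := by simp [hv.1, hv.2]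
    rw [norm_add_sq_real, norm_sub_sq_real, hsymm, real_inner_comm (A v.2)] at h1
    have h2 : ∀ u : E, ‖u‖ ^ 2 = 0 → u = 0 := fun u hu => by simpa using hu
    have hA1 := sq_nonneg ‖A v.1‖
    have hA2 := sq_nonneg ‖A v.2‖
    have hB1 := sq_nonneg ‖B v.1‖
    have hB2 := sq_nonneg ‖B v.2‖
    rw [real_inner_comm] at h1
    exact Prod.ext (hinj _ (h2 _ (by linarith)) (h2 _ (by linarith)))
      (hinj _ (h2 _ (by linarith)) (h2 _ (by linarith)))
  obtain ⟨v, hv⟩ := LinearMap.injective_iff_surjective.1 hRinj (a, b)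
  rw [hR, Prod.mk.injEq] at hv
  have h1 := hab v.2
  rw [← hv.1, ← hv.2, inner_add_left, inner_sub_left, hsymm, real_inner_comm,
    real_inner_self_eq_norm_sq, real_inner_self_eq_norm_sq] at h1
  have h2 : ∀ u : E, ‖u‖ ^ 2 = 0 → u = 0 := fun u hu => by simpa using hu
  have hA2 := sq_nonneg ‖A v.2‖
  have hB2 := sq_nonneg ‖B v.2‖
  have h0 : v.2 = 0 := hinj _ (h2 _ (by linarith)) (h2 _ (by linarith))
  rw [h0] at hv
  exact ⟨v.1, by simpa using hv.1, by simpa using hv.2⟩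

/-- A family of conic Lagrangian immersions `Φ (·, t)`, parameterised by nonzero vectors whose
norm is that of the covector. -/
structure IsConeFamily (Φ : E × ℝ → E × E) : Prop where
  smooth : ∀ y ≠ 0, ∀ t, ContDiffAt ℝ (⊤ : ℕ∞) Φ (y, t)
  norm_snd : ∀ y ≠ 0, ∀ t ∈ Icc (0 : ℝ) 1, ‖(Φ (y, t)).2‖ = ‖y‖
  imm : ∀ y ≠ 0, ∀ t ∈ Icc (0 : ℝ) 1, ∀ w, fderiv ℝ Φ (y, t) (w, 0) = 0 → w = 0
  leg : ∀ y ≠ 0, ∀ t ∈ Icc (0 : ℝ) 1, ∀ w, ⟪(fderiv ℝ Φ (y, t) (w, 0)).1, (Φ (y, t)).2⟫ = 0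

variable {Φ : E × ℝ → E × E}

/-- The Hamiltonian vector field is the velocity of the family modulo its tangent space. -/
lemma IsConeFamily.exists_tangent_eq [FiniteDimensional ℝ E] (hΦ : IsConeFamily Φ)
    {f : E × E → ℝ} {y : E} (hy : y ≠ 0) {t : ℝ} (ht : t ∈ Icc (0 : ℝ) 1)
    (hf : DifferentiableAt ℝ f (Φ (y, t)))
    (hfΦ : ∀ᶠ y' in 𝓝 y, f (Φ (y', t)) = ⟪(fderiv ℝ Φ (y', t) (0, 1)).1, (Φ (y', t)).2⟫) :
    ∃ v, fderiv ℝ Φ (y, t) (v, 0) =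
      (gradSnd f (Φ (y, t)), -gradFst f (Φ (y, t))) - fderiv ℝ Φ (y, t) (0, 1) := by
  have hsm := hΦ.smooth y hy t
  have hsm2 : ContDiffAt ℝ 2 Φ (y, t) := mod_cast contDiffAt_infty.1 hsm 2
  have hd : HasFDerivAt Φ (fderiv ℝ Φ (y, t)) (y, t) :=
    (hsm.differentiableAt (by simp)).hasFDerivAt
  have hD : HasFDerivAt (fderiv ℝ Φ) (fderiv ℝ (fderiv ℝ Φ) (y, t)) (y, t) :=
    ((hsm2.fderiv_right (m := 1) (by norm_num)).differentiableAt one_ne_zero).hasFDerivAt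
  have hsymm : IsSymmSndFDerivAt ℝ Φ (y, t) := hsm2.isSymmSndFDerivAt (by simp)
  set D := fderiv ℝ Φ (y, t)
  set D2 := fderiv ℝ (fderiv ℝ Φ) (y, t)
  have hθ : ∀ w, HasFDerivAt (fun z => ⟪(fderiv ℝ Φ z w).1, (Φ z).2⟫)
      (((innerSL ℝ (D w).1).comp ((ContinuousLinearMap.snd ℝ E E).comp D)) +
        ((innerSL ℝ (Φ (y, t)).2).comp ((ContinuousLinearMap.fst ℝ E E).comp (D2.flip w)))) (y, t) := by
    intro w
    have h1 : HasFDerivAt (fun z => (fderiv ℝ Φ z w).1)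
        ((ContinuousLinearMap.fst ℝ E E).comp (D2.flip w)) (y, t) := by
      have := hD.clm_apply (hasFDerivAt_const w (y, t))
      simp only [ContinuousLinearMap.comp_zero, zero_add] at this
      exact (ContinuousLinearMap.fst ℝ E E).hasFDerivAt.comp (y, t) this
    have h2 : HasFDerivAt (fun z => (Φ z).2) ((ContinuousLinearMap.snd ℝ E E).comp D) (y, t) :=
      (ContinuousLinearMap.snd ℝ E E).hasFDerivAt.comp (y, t) hd
    refine (h1.inner ℝ h2).congr_fderiv ?_
    ext u <;> simp [fderivInnerCLM_apply, real_inner_comm, D]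
  have hleft : ∀ w' w, ⟪(D w).1, (D (w', 0)).2⟫ + ⟪(Φ (y, t)).2, (D2 (w', 0) w).1⟫ =
      fderiv ℝ (fun y' => ⟪(fderiv ℝ Φ (y', t) w).1, (Φ (y', t)).2⟫) y w' := by
    intro w' w
    have := (hθ w).comp y (hasFDerivAt_prodMk_left (𝕜 := ℝ) y t)
    change HasFDerivAt (fun y' => ⟪(fderiv ℝ Φ (y', t) w).1, (Φ (y', t)).2⟫) _ y at this
    rw [this.fderiv]
    simp
  have hleg1 : ∀ w' w, ⟪(D (w, 0)).1, (D (w', 0)).2⟫ +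
      ⟪(Φ (y, t)).2, (D2 (w', 0) (w, 0)).1⟫ = 0 := by
    intro w' w
    rw [hleft]
    have : (fun y' => ⟪(fderiv ℝ Φ (y', t) (w, 0)).1, (Φ (y', t)).2⟫) =ᶠ[𝓝 y] fun _ => 0 := by
      filter_upwards [isOpen_ne.mem_nhds hy] with y' hy'
      exact hΦ.leg y' hy' t ht w
    rw [this.fderiv_eq]
    simp
  have hleg2 : ∀ w, ⟪(D (w, 0)).1, (D (0, 1)).2⟫ +
      ⟪(Φ (y, t)).2, (D2 (0, 1) (w, 0)).1⟫ = 0 := by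
    intro w
    have h1 := (hθ (w, 0)).comp t (hasFDerivAt_prodMk_right (𝕜 := ℝ) y t)
    have h2 := h1.hasDerivAt.hasDerivWithinAt (s := Icc (0 : ℝ) 1)
    have h3 : HasDerivWithinAt (fun _ : ℝ => (0 : ℝ)) 0 (Icc (0 : ℝ) 1) t :=
      hasDerivWithinAt_const _ _ _
    have h4 := h3.congr (f₁ := (fun z => ⟪(fderiv ℝ Φ z (w, 0)).1, (Φ z).2⟫) ∘ fun x => (y, x))
      (fun x hx => hΦ.leg y hy x hx w) (hΦ.leg y hy t ht w)
    have h5 := (uniqueDiffOn_Icc (zero_lt_one' ℝ) t ht).eq_deriv _ h2 h4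
    simpa using h5
  have hHam : ∀ w, fderiv ℝ f (Φ (y, t)) (D (w, 0)) =
      ⟪(D (0, 1)).1, (D (w, 0)).2⟫ + ⟪(Φ (y, t)).2, (D2 (w, 0) (0, 1)).1⟫ := by
    intro w
    rw [hleft, ← Filter.EventuallyEq.fderiv_eq hfΦ]
    have h1 := hf.hasFDerivAt.comp y (hd.comp y (hasFDerivAt_prodMk_left (𝕜 := ℝ) y t))
    change HasFDerivAt (fun y' => f (Φ (y', t))) _ y at h1
    rw [h1.fderiv]
    simp
  let A : E →ₗ[ℝ] E := ((ContinuousLinearMap.fst ℝ E E).comp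
    (D.comp (ContinuousLinearMap.inl ℝ E ℝ))).toLinearMap
  let B : E →ₗ[ℝ] E := ((ContinuousLinearMap.snd ℝ E E).comp
    (D.comp (ContinuousLinearMap.inl ℝ E ℝ))).toLinearMap
  obtain ⟨v, h1, h2⟩ := exists_eq_of_symplectic_orthogonal (A := A) (B := B)
    (fun v w => by
      have h1 := hleg1 w v
      have h2 := hleg1 v w
      rw [hsymm.eq] at h1
      change ⟪(D (v, 0)).1, (D (w, 0)).2⟫ = ⟪(D (w, 0)).1, (D (v, 0)).2⟫
      linarith)
    (fun v h1 h2 => hΦ.imm y hy t ht v (Prod.ext h1 h2))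
    (a := gradSnd f (Φ (y, t)) - (D (0, 1)).1) (b := -gradFst f (Φ (y, t)) - (D (0, 1)).2)
    (fun w => by
      have h1 := hleg2 w
      have h2 := hHam w
      rw [hsymm.eq, fderiv_eq_inner_grad] at h2
      change ⟪_, (D (w, 0)).2⟫ = ⟪_, (D (w, 0)).1⟫
      rw [inner_sub_left, inner_sub_left, inner_neg_left, real_inner_comm (D (w, 0)).1 (D (0, 1)).2]
      linarith)
  exact ⟨v, Prod.ext h1 h2⟩

end Cone

section Cutoff

variable {V W : Type*} [NormedAddCommGroup V] [NormedSpace ℝ V] [FiniteDimensional ℝ V]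
  [NormedAddCommGroup W] [NormedSpace ℝ W]

open scoped Manifold in
lemma exists_contDiff_cutoff {K U : Set V} (hK : IsCompact K) (hU : IsOpen U) (hKU : K ⊆ U) :
    ∃ η : V → ℝ, ContDiff ℝ (⊤ : ℕ∞) η ∧ HasCompactSupport η ∧ tsupport η ⊆ U ∧
      (∀ᶠ x in 𝓝ˢ K, η x = 1) ∧ ∀ x, η x ∈ Icc (0 : ℝ) 1 := by
  obtain ⟨L, hL, hKL, hLU⟩ := exists_compact_between hK hU hKU
  obtain ⟨η, h1, h0, hI⟩ := exists_contMDiffMap_one_nhds_of_subset_interior (n := ⊤)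
    𝓘(ℝ, V) hK.isClosed hKL
  have hsupp : tsupport η ⊆ L := closure_minimal
    (fun x hx => by_contra fun hxL => hx (h0 x hxL)) hL.isClosed
  exact ⟨η, η.contMDiff.contDiff, hL.of_isClosed_subset (isClosed_tsupport _) hsupp,
    hsupp.trans hLU, h1, hI⟩

lemma exists_contDiff_eventuallyEq {K U : Set V} (hK : IsCompact K) (hU : IsOpen U) (hKU : K ⊆ U)
    {f : V → W} (hf : ∀ x ∈ U, ContDiffAt ℝ (⊤ : ℕ∞) f x) :
    ∃ g : V → W, ContDiff ℝ (⊤ : ℕ∞) g ∧ HasCompactSupport g ∧ ∀ x ∈ K, g =ᶠ[𝓝 x] f := by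
  obtain ⟨η, hη, hc, hs, h1, -⟩ := exists_contDiff_cutoff hK hU hKU
  refine ⟨fun x => η x • f x, contDiff_iff_contDiffAt.2 fun x => ?_, hc.smul_right, fun x hx => ?_⟩
  · by_cases hx : x ∈ tsupport η
    · exact hη.contDiffAt.smul (hf x (hs hx))
    · refine (contDiffAt_const (c := (0 : W))).congr_of_eventuallyEq ?_
      filter_upwards [(isClosed_tsupport η).isOpen_compl.mem_nhds hx] with x' hx'
      rw [image_eq_zero_of_notMem_tsupport hx', zero_smul]
  · filter_upwards [eventually_nhdsSet_iff_forall.1 h1 x hx] with x' hx'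
    rw [hx', one_smul]

end Cutoff

lemma exists_fderiv_bounds {V W : Type*} [NormedAddCommGroup V] [NormedSpace ℝ V]
    [NormedAddCommGroup W] [NormedSpace ℝ W] {f : V → W} (hf : ContDiff ℝ 2 f)
    (hfc : HasCompactSupport f) : ∃ M L : ℝ, 0 ≤ M ∧ 0 ≤ L ∧ (∀ z, ‖fderiv ℝ f z‖ ≤ M) ∧
      ∀ z z', ‖fderiv ℝ f z - fderiv ℝ f z'‖ ≤ L * ‖z - z'‖ := by
  obtain ⟨M, hM⟩ := (hfc.fderiv ℝ).exists_bound_of_continuous (hf.continuous_fderiv two_ne_zero)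
  obtain ⟨L, hL⟩ := (hf.fderiv_right (m := 1) (by norm_num)).lipschitzWith_of_hasCompactSupport
    (hfc.fderiv ℝ) one_ne_zero
  exact ⟨M, L, (norm_nonneg _).trans (hM 0), L.2, hM, fun z z' => by
    simpa only [dist_eq_norm] using hL.dist_le_mul z z'⟩

section Tracking

variable {E : Type*} [NormedAddCommGroup E] [InnerProductSpace ℝ E] [FiniteDimensional ℝ E]

/-- The Hamiltonian vector field of `f`. -/
def hamVec (f : E × E → ℝ) (z : E × E) : E × E := (gradSnd f z, -gradFst f z)

lemma norm_gradFst_sub_le (f : E × E → ℝ) (z z' : E × E) :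
    ‖gradFst f z - gradFst f z'‖ ≤ ‖fderiv ℝ f z - fderiv ℝ f z'‖ := by
  rw [gradFst, gradFst, ← map_sub, LinearIsometryEquiv.norm_map, ← ContinuousLinearMap.sub_comp]
  refine (ContinuousLinearMap.opNorm_comp_le _ _).trans ?_
  exact mul_le_of_le_one_right (norm_nonneg _) (ContinuousLinearMap.norm_inl_le_one ℝ E E)

lemma norm_gradSnd_sub_le (f : E × E → ℝ) (z z' : E × E) :
    ‖gradSnd f z - gradSnd f z'‖ ≤ ‖fderiv ℝ f z - fderiv ℝ f z'‖ := by
  rw [gradSnd, gradSnd, ← map_sub, LinearIsometryEquiv.norm_map, ← ContinuousLinearMap.sub_comp]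
  refine (ContinuousLinearMap.opNorm_comp_le _ _).trans ?_
  exact mul_le_of_le_one_right (norm_nonneg _) (ContinuousLinearMap.norm_inr_le_one ℝ E E)

lemma norm_gradFst_le (f : E × E → ℝ) (z : E × E) : ‖gradFst f z‖ ≤ ‖fderiv ℝ f z‖ := by
  rw [gradFst, LinearIsometryEquiv.norm_map]
  refine (ContinuousLinearMap.opNorm_comp_le _ _).trans ?_
  exact mul_le_of_le_one_right (norm_nonneg _) (ContinuousLinearMap.norm_inl_le_one ℝ E E)

lemma norm_gradSnd_le (f : E × E → ℝ) (z : E × E) : ‖gradSnd f z‖ ≤ ‖fderiv ℝ f z‖ := by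
  rw [gradSnd, LinearIsometryEquiv.norm_map]
  refine (ContinuousLinearMap.opNorm_comp_le _ _).trans ?_
  exact mul_le_of_le_one_right (norm_nonneg _) (ContinuousLinearMap.norm_inr_le_one ℝ E E)

/-- Uniform bounds for the Hamiltonian vector field of a compactly supported Hamiltonian. -/
lemma exists_hamVec_bounds {H : ℝ × (E × E) → ℝ} (hH : ContDiff ℝ 2 H)
    (hHc : HasCompactSupport H) : ∃ M L : ℝ, 0 ≤ M ∧ 0 ≤ L ∧
      (∀ t z, ‖hamVec (fun z => H (t, z)) z‖ ≤ M) ∧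
      ∀ t z z', ‖hamVec (fun z => H (t, z)) z - hamVec (fun z => H (t, z)) z'‖ ≤ L * ‖z - z'‖ := by
  obtain ⟨M, L, hM0, hL0, hM, hL⟩ := exists_fderiv_bounds hH hHc
  have hfd : ∀ t z, fderiv ℝ (fun z => H (t, z)) z =
      (fderiv ℝ H (t, z)).comp (ContinuousLinearMap.inr ℝ ℝ (E × E)) := fun t z =>
    ((hH.differentiable two_ne_zero (t, z)).hasFDerivAt.comp z
      (hasFDerivAt_prodMk_right (𝕜 := ℝ) t z)).fderiv
  have hinr := ContinuousLinearMap.norm_inr_le_one ℝ ℝ (E × E)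
  have hM' : ∀ t z, ‖fderiv ℝ (fun z => H (t, z)) z‖ ≤ M := fun t z => by
    rw [hfd]
    exact (ContinuousLinearMap.opNorm_comp_le _ _).trans
      ((mul_le_of_le_one_right (norm_nonneg _) hinr).trans (hM _))
  have hL' : ∀ t z z', ‖fderiv ℝ (fun z => H (t, z)) z - fderiv ℝ (fun z => H (t, z)) z'‖ ≤
      L * ‖z - z'‖ := fun t z z' => by
    rw [hfd, hfd, ← ContinuousLinearMap.sub_comp]
    refine (ContinuousLinearMap.opNorm_comp_le _ _).trans
      ((mul_le_of_le_one_right (norm_nonneg _) hinr).trans ?_)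
    have := hL (t, z) (t, z')
    rwa [← dist_eq_norm (t, z), dist_prod_same_left, dist_eq_norm] at this
  refine ⟨M, L, hM0, hL0, fun t z => ?_, fun t z z' => ?_⟩
  · rw [hamVec, norm_prod_le_iff, norm_neg]
    exact ⟨(norm_gradSnd_le _ _).trans (hM' t z), (norm_gradFst_le _ _).trans (hM' t z)⟩
  · rw [hamVec, hamVec, Prod.mk_sub_mk, norm_prod_le_iff, neg_sub_neg, norm_sub_rev (gradFst _ z')]
    exact ⟨(norm_gradSnd_sub_le _ _ _).trans (hL' t z z'),
      (norm_gradFst_sub_le _ _ _).trans (hL' t z z')⟩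

lemma isCompact_annulus_prod (r R : ℝ) :
    IsCompact ({y : E | r ≤ ‖y‖ ∧ ‖y‖ ≤ R} ×ˢ Icc (0 : ℝ) 1) := by
  refine IsCompact.prod ?_ isCompact_Icc
  refine (isCompact_closedBall (0 : E) R).of_isClosed_subset ?_ fun y hy => by simpa using hy.2
  exact (isClosed_le continuous_const continuous_norm).inter
    (isClosed_le continuous_norm continuous_const)

lemma exists_pos_le_norm_fderiv {Ψ : E × ℝ → E × E} (hΨ : ContDiff ℝ 1 Ψ) {K : Set (E × ℝ)}
    (hK : IsCompact K) (h : ∀ z ∈ K, ∀ w, fderiv ℝ Ψ z (w, 0) = 0 → w = 0) :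
    ∃ c > 0, ∀ z ∈ K, ∀ w, c * ‖w‖ ≤ ‖fderiv ℝ Ψ z (w, 0)‖ := by
  have hcont : Continuous fun u : (E × ℝ) × E => ‖fderiv ℝ Ψ u.1 (u.2, 0)‖ :=
    (((hΨ.continuous_fderiv one_ne_zero).comp continuous_fst).clm_apply (by fun_prop)).norm
  have hKS : IsCompact (K ×ˢ sphere (0 : E) 1) := hK.prod (isCompact_sphere _ _)
  obtain ⟨c, hc, hcK⟩ : ∃ c > 0, ∀ u ∈ K ×ˢ sphere (0 : E) 1, c ≤ ‖fderiv ℝ Ψ u.1 (u.2, 0)‖ := by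
    refine hKS.exists_forall_le' (a := 0) hcont.continuousOn fun u hu => ?_
    refine norm_pos_iff.2 fun h0 => ?_
    have := h u.1 hu.1 u.2 h0
    have h2 := hu.2
    rw [this] at h2
    simp at h2
  refine ⟨c, hc, fun z hz w => ?_⟩
  by_cases hw : w = 0
  · simp [hw]
  have hw' : 0 < ‖w‖ := norm_pos_iff.2 hw
  have := hcK (z, ‖w‖⁻¹ • w) ⟨hz, by simp [norm_smul, hw'.ne']⟩
  have h2 : ((‖w‖⁻¹ • w, 0) : E × ℝ) = ‖w‖⁻¹ • (w, 0) := by simp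
  simp only [h2, map_smul, norm_smul, norm_inv, norm_norm] at this
  rw [inv_mul_eq_div, le_div_iff₀ hw'] at this
  exact this

/-- One step of the discrete flow moves along the family up to a quadratic error. -/
lemma IsConeFamily.exists_step {Φ : E × ℝ → E × E} (hΦ : IsConeFamily Φ) {H : ℝ × (E × E) → ℝ}
    (hH : ContDiff ℝ 2 H) (hHc : HasCompactSupport H) {a b : ℝ} (ha : 0 < a) (hab : a ≤ b)
    (hHΦ : ∀ t ∈ Icc (0 : ℝ) 1, ∀ y, a / 4 < ‖y‖ → ‖y‖ < 4 * b →
      H (t, Φ (y, t)) = ⟪(fderiv ℝ Φ (y, t) (0, 1)).1, (Φ (y, t)).2⟫) :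
    ∃ C ≥ 0, ∃ ε₀ > 0, ∀ ε > 0, ε ≤ ε₀ → ∀ t ∈ Icc (0 : ℝ) 1, t + ε ∈ Icc (0 : ℝ) 1 →
      ∀ x p x' p' : E, a ≤ ‖p‖ → ‖p‖ ≤ b →
      x' = x + ε • gradSnd (fun z => H (t, z)) (x, p') →
      p = p' + ε • gradFst (fun z => H (t, z)) (x, p') →
      ∀ y ≠ 0, ‖(x, p) - Φ (y, t)‖ ≤ a / 2 →
      ∃ y' ≠ 0, ‖(x', p') - Φ (y', t + ε)‖ ≤ (1 + C * ε) * ‖(x, p) - Φ (y, t)‖ + C * ε ^ 2 := by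
  set K : Set (E × ℝ) := {y : E | a / 4 ≤ ‖y‖ ∧ ‖y‖ ≤ 4 * b} ×ˢ Icc (0 : ℝ) 1 with hKdef
  have hK : IsCompact K := isCompact_annulus_prod _ _
  have hK0 : ∀ y t, (y, t) ∈ K → y ≠ 0 := by
    rintro y t ⟨⟨h1, -⟩, -⟩ rfl
    rw [norm_zero] at h1
    linarith
  obtain ⟨Ψ, hΨ, hΨc, hΨΦ⟩ := exists_contDiff_eventuallyEq hK
    (U := {z : E × ℝ | z.1 ≠ 0}) (isOpen_ne.preimage continuous_fst)
    (fun z hz => hK0 z.1 z.2 hz) (f := Φ) (fun z hz => hΦ.smooth z.1 hz z.2)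
  have hΨ2 : ContDiff ℝ 2 Ψ := mod_cast contDiff_infty.1 hΨ 2
  obtain ⟨MΨ, LΨ, hMΨ0, hLΨ0, hMΨ, hLΨ⟩ := exists_fderiv_bounds hΨ2 hΨc
  obtain ⟨c, hc, hcK⟩ := exists_pos_le_norm_fderiv (hΨ2.of_le one_le_two) hK (fun z hz w hw =>
    hΦ.imm z.1 (hK0 _ _ hz) z.2 hz.2 w (by rw [← (hΨΦ z hz).fderiv_eq]; exact hw))
  obtain ⟨M, L, hM0, hL0, hM, hL⟩ := exists_hamVec_bounds hH hHc
  have taylor : ∀ z u, ‖Ψ (z + u) - Ψ z - fderiv ℝ Ψ z u‖ ≤ LΨ * ‖u‖ ^ 2 := by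
    intro z u
    have := (convex_closedBall z ‖u‖).norm_image_sub_le_of_norm_fderiv_le' (𝕜 := ℝ) (f := Ψ)
      (φ := fderiv ℝ Ψ z) (x := z) (y := z + u) (C := LΨ * ‖u‖)
      (fun x _ => hΨ2.differentiable two_ne_zero x) (fun x hx => by
        refine (hLΨ x z).trans ?_
        gcongr
        rwa [← dist_eq_norm]) (mem_closedBall_self (norm_nonneg _)) (by simp)
    rw [add_sub_cancel_left] at this
    calc _ ≤ _ := this
      _ = _ := by ring
  set Cv := (M + MΨ) / c with hCv
  have hCv0 : 0 ≤ Cv := by positivity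
  refine ⟨L + L * M + LΨ * (Cv + 1) ^ 2, by positivity, a / 4 / (Cv + 1), by positivity, ?_⟩
  intro ε hε hεε t ht htε x p x' p' hpa hpb hx' hp' y hy hd
  set d := ‖(x, p) - Φ (y, t)‖ with hd'
  have hpy : |‖p‖ - ‖y‖| ≤ d := by
    rw [← hΦ.norm_snd y hy t ht]
    exact (abs_norm_sub_norm_le _ _).trans (norm_snd_le ((x, p) - Φ (y, t)))
  obtain ⟨hpy1, hpy2⟩ := abs_le.1 hpy
  have hyK : (y, t) ∈ K := ⟨⟨by linarith, by linarith⟩, ht⟩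
  obtain ⟨v, hv⟩ := hΦ.exists_tangent_eq (f := fun z => H (t, z)) hy ht
    ((hH.differentiable two_ne_zero).differentiableAt.comp _ (by fun_prop)) (by
      have h1 : ∀ᶠ y' in 𝓝 y, a / 4 < ‖y'‖ :=
        continuous_norm.continuousAt.eventually (lt_mem_nhds (by linarith))
      have h2 : ∀ᶠ y' in 𝓝 y, ‖y'‖ < 4 * b :=
        continuous_norm.continuousAt.eventually (gt_mem_nhds (by linarith))
      filter_upwards [h1, h2] with y' h1 h2 using hHΦ t ht y' h1 h2)
  change _ = hamVec (fun z => H (t, z)) (Φ (y, t)) - _ at hv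
  rw [← (hΨΦ _ hyK).fderiv_eq, ← (hΨΦ _ hyK).eq_of_nhds] at hv
  have hvn : ‖v‖ ≤ Cv := by
    rw [hCv, le_div_iff₀ hc, mul_comm]
    refine (hcK _ hyK v).trans ?_
    rw [hv]
    refine (norm_sub_le _ _).trans (add_le_add (hM _ _) ?_)
    refine ((fderiv ℝ Ψ (y, t)).le_opNorm _).trans ?_
    have : ‖((0 : E), (1 : ℝ))‖ = 1 := by simp [Prod.norm_def]
    rw [this, mul_one]
    exact hMΨ _
  have hεv : ‖ε • v‖ ≤ a / 4 := by
    rw [norm_smul, Real.norm_of_nonneg hε.le]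
    rw [le_div_iff₀ (by positivity)] at hεε
    refine le_trans ?_ hεε
    gcongr
    linarith
  have hy'1 : ‖y‖ - ‖ε • v‖ ≤ ‖y + ε • v‖ := by
    have := norm_sub_norm_le y (-(ε • v))
    rwa [norm_neg, sub_neg_eq_add] at this
  have hy'2 := norm_add_le y (ε • v)
  have hy'K : (y + ε • v, t + ε) ∈ K := ⟨⟨by linarith, by linarith⟩, htε⟩
  refine ⟨y + ε • v, hK0 _ _ hy'K, ?_⟩
  have hT := taylor (y, t) (ε • (v, 1))
  have h1 : (y, t) + ε • (v, (1 : ℝ)) = (y + ε • v, t + ε) := by simp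
  have h2 : fderiv ℝ Ψ (y, t) (ε • (v, (1 : ℝ))) =
      ε • hamVec (fun z => H (t, z)) (Ψ (y, t)) := by
    have : (v, (1 : ℝ)) = (v, 0) + (0, 1) := by simp
    rw [map_smul, this, map_add, hv, sub_add_cancel]
  have h3 : ‖ε • (v, (1 : ℝ))‖ ≤ ε * (Cv + 1) := by
    rw [norm_smul, Real.norm_of_nonneg hε.le]
    gcongr
    rw [norm_prod_le_iff]
    exact ⟨hvn.trans (by linarith), by simpa using hCv0⟩
  rw [h1, h2] at hT
  rw [← (hΨΦ _ hy'K).eq_of_nhds]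
  rw [← (hΨΦ _ hyK).eq_of_nhds] at hd'
  set X := hamVec (fun z => H (t, z))
  have hx2 : (x', p') = (x, p) + ε • X (x, p') := by
    ext1
    · exact hx'
    · simp only [X, hamVec, Prod.snd_add, Prod.smul_snd, smul_neg]
      rw [hp']
      abel
  have hpp : ‖p' - p‖ ≤ ε * M := by
    have h5 : p' - p = (ε • X (x, p')).2 := by
      have := congrArg Prod.snd hx2
      simp only [Prod.snd_add] at this
      exact sub_eq_of_eq_add' this
    rw [h5]
    refine (norm_snd_le _).trans ?_
    rw [norm_smul, Real.norm_of_nonneg hε.le]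
    gcongr
    exact hM _ _
  have hX : ‖X (x, p') - X (Ψ (y, t))‖ ≤ L * (d + ε * M) := by
    refine (hL _ _ _).trans ?_
    gcongr
    have h6 : (x, p') - Ψ (y, t) = ((x, p) - Ψ (y, t)) + (0, p' - p) := by
      ext1 <;> simp
    rw [h6, hd']
    refine (norm_add_le _ _).trans ?_
    gcongr
    rw [norm_prod_le_iff]
    exact ⟨by simpa using by positivity, hpp⟩
  have hdec : (x', p') - Ψ (y + ε • v, t + ε) = ((x, p) - Ψ (y, t)) +
      ε • (X (x, p') - X (Ψ (y, t))) -
      (Ψ (y + ε • v, t + ε) - Ψ (y, t) - ε • X (Ψ (y, t))) := by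
    rw [hx2, smul_sub]
    abel
  have hd0 : 0 ≤ d := norm_nonneg _
  rw [hdec]
  calc _ ≤ d + ε * (L * (d + ε * M)) + LΨ * (ε * (Cv + 1)) ^ 2 := by
        refine (norm_sub_le _ _).trans (add_le_add ((norm_add_le _ _).trans
          (add_le_add hd'.ge ?_)) (hT.trans (by gcongr)))
        rw [norm_smul, Real.norm_of_nonneg hε.le]
        gcongr
    _ ≤ _ := by
        have e1 : 0 ≤ L * M * (ε * d) := by positivity
        have e2 : 0 ≤ LΨ * (Cv + 1) ^ 2 * (ε * d) := by positivity
        have e3 : 0 ≤ L * ε ^ 2 := by positivity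
        nlinarith

end Tracking

section Block

variable {E : Type*} [NormedAddCommGroup E] [InnerProductSpace ℝ E] [FiniteDimensional ℝ E]

/-- A discrete orbit which starts close to a family of cones stays close to it. -/
lemma IsConeFamily.exists_tracking {Φ : E × ℝ → E × E} (hΦ : IsConeFamily Φ)
    {H : ℝ × (E × E) → ℝ} (hH : ContDiff ℝ 2 H) (hHc : HasCompactSupport H) {a b : ℝ}
    (ha : 0 < a) (hab : a ≤ b)
    (hHΦ : ∀ t ∈ Icc (0 : ℝ) 1, ∀ y, a / 4 < ‖y‖ → ‖y‖ < 4 * b →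
      H (t, Φ (y, t)) = ⟪(fderiv ℝ Φ (y, t) (0, 1)).1, (Φ (y, t)).2⟫) {D : ℝ} (hD : 0 ≤ D) :
    ∃ D' ≥ 0, ∃ N₀ : ℕ, ∀ N : ℕ, N₀ ≤ N → 0 < N → ∀ xs ps : ℕ → E,
      (∀ i < N, xs (i + 1) =
        xs i + (N : ℝ)⁻¹ • gradSnd (fun z => H (i * (N : ℝ)⁻¹, z)) (xs i, ps (i + 1))) →
      (∀ i < N, ps i =
        ps (i + 1) + (N : ℝ)⁻¹ • gradFst (fun z => H (i * (N : ℝ)⁻¹, z)) (xs i, ps (i + 1))) →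
      (∀ i ≤ N, a ≤ ‖ps i‖ ∧ ‖ps i‖ ≤ b) →
      (∃ y ≠ 0, ‖(xs 0, ps 0) - Φ (y, 0)‖ ≤ D * (N : ℝ)⁻¹) →
      ∃ y ≠ 0, ‖(xs N, ps N) - Φ (y, 1)‖ ≤ D' * (N : ℝ)⁻¹ := by
  obtain ⟨C, hC, ε₀, hε₀, hstep⟩ := hΦ.exists_step hH hHc ha hab hHΦ
  set D' := Real.exp C * (D + C) with hD'
  have hD'0 : 0 ≤ D' := by positivity
  obtain ⟨N₀, hN₀⟩ := exists_nat_gt (max (1 / ε₀) (D' / (a / 2)))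
  refine ⟨D', hD'0, N₀, fun N hN hN0 xs ps hx hp hps hstart => ?_⟩
  set ε := (N : ℝ)⁻¹ with hε
  have hNpos : (0 : ℝ) < N := by exact_mod_cast hN0
  have hεpos : 0 < ε := by positivity
  have hNε : N * ε = 1 := mul_inv_cancel₀ hNpos.ne'
  have hNN : max (1 / ε₀) (D' / (a / 2)) < N := hN₀.trans_le (by exact_mod_cast hN)
  have hεε₀ : ε ≤ ε₀ := by
    have := (le_max_left _ _).trans hNN.le
    rw [hε]
    exact inv_le_of_inv_le₀ hε₀ (by rwa [one_div] at this)
  have hD'ε : D' * ε ≤ a / 2 := by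
    have := (le_max_right _ _).trans hNN.le
    rw [div_le_iff₀ (by positivity)] at this
    calc D' * ε ≤ N * (a / 2) * ε := by gcongr
      _ = N * ε * (a / 2) := by ring
      _ = a / 2 := by rw [hNε, one_mul]
  have hpow : ∀ i ≤ N, (1 + C * ε) ^ i * ((D + C * (i * ε)) * ε) ≤ D' * ε := by
    intro i hi
    have hiε : i * ε ≤ 1 := by
      rw [← hNε]
      gcongr
    have h1 : (1 + C * ε) ^ i ≤ Real.exp C := by
      calc (1 + C * ε) ^ i ≤ Real.exp (C * ε) ^ i := by
            gcongr
            rw [add_comm]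
            exact Real.add_one_le_exp _
        _ = Real.exp (C * (i * ε)) := by rw [← Real.exp_nat_mul]; ring_nf
        _ ≤ Real.exp C := Real.exp_le_exp.2 (mul_le_of_le_one_right hC hiε)
    calc _ ≤ Real.exp C * ((D + C * 1) * ε) := by gcongr
      _ = D' * ε := by rw [hD']; ring
  have key : ∀ i ≤ N, ∃ y ≠ 0,
      ‖(xs i, ps i) - Φ (y, i * ε)‖ ≤ (1 + C * ε) ^ i * ((D + C * (i * ε)) * ε) := by
    intro i
    induction i with
    | zero => simpa using hstart
    | succ i ih =>
      intro hi
      obtain ⟨y, hy, hyd⟩ := ih (by omega)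
      have ht : ∀ j ≤ N, (j : ℝ) * ε ∈ Icc (0 : ℝ) 1 := fun j hj => by
        refine ⟨by positivity, ?_⟩
        rw [← hNε]
        gcongr
      have hcast : ((i + 1 : ℕ) : ℝ) * ε = i * ε + ε := by push_cast; ring
      obtain ⟨y', hy', hyd'⟩ := hstep ε hεpos hεε₀ (i * ε) (ht i (by omega))
        (hcast ▸ ht (i + 1) hi) (xs i) (ps i) (xs (i + 1)) (ps (i + 1)) (hps i (by omega)).1
        (hps i (by omega)).2 (hx i (by omega)) (hp i (by omega)) y hy
        (hyd.trans ((hpow i (by omega)).trans hD'ε))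
      refine ⟨y', hy', ?_⟩
      rw [hcast]
      refine hyd'.trans ?_
      have h1 : 1 ≤ (1 + C * ε) ^ (i + 1) := one_le_pow₀ (by
        have : 0 ≤ C * ε := by positivity
        linarith)
      calc _ ≤ (1 + C * ε) * ((1 + C * ε) ^ i * ((D + C * (i * ε)) * ε)) +
            (1 + C * ε) ^ (i + 1) * (C * ε ^ 2) :=
              add_le_add (mul_le_mul_of_nonneg_left hyd (by positivity))
                (le_mul_of_one_le_left (by positivity) h1)
        _ = _ := by ring
  obtain ⟨y, hy, hyd⟩ := key N le_rfl
  rw [hNε] at hyd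
  refine ⟨y, hy, hyd.trans ?_⟩
  simpa [hNε] using hpow N le_rfl

end Block

section ConeMap

variable {m : ℕ} {F : EuclideanSpace ℝ (Fin m) × ℝ → STSp m}

/-- The positively homogeneous extension of an isotopy of the cosphere bundle. -/
def coneMap (F : EuclideanSpace ℝ (Fin m) × ℝ → STSp m) (z : EuclideanSpace ℝ (Fin m) × ℝ) :
    STSp m :=
  ((F (‖z.1‖⁻¹ • z.1, z.2)).1, ‖z.1‖ • (F (‖z.1‖⁻¹ • z.1, z.2)).2)

/-- The speed `⟨∂x/∂t, q⟩` of an isotopy. -/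
def legSpeed (F : EuclideanSpace ℝ (Fin m) × ℝ → STSp m) (z : EuclideanSpace ℝ (Fin m) × ℝ) : ℝ :=
  ⟪(fderiv ℝ F z (0, 1)).1, (F z).2⟫

lemma normalize_mem_sph {y : EuclideanSpace ℝ (Fin m)} (hy : y ≠ 0) : ‖y‖⁻¹ • y ∈ sph m := by
  simp [sph, norm_smul, hy]

lemma legSpeed_eq_deriv (hF : ContDiff ℝ (⊤ : ℕ∞) F) (s : EuclideanSpace ℝ (Fin m)) (t : ℝ) :
    legSpeed F (s, t) = ⟪deriv (fun t' => (F (s, t')).1) t, (F (s, t)).2⟫ := by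
  have h := ((hF.differentiable (by simp) (s, t)).hasFDerivAt.comp t
    (hasFDerivAt_prodMk_right (𝕜 := ℝ) s t)).fst.hasDerivAt.deriv
  simp only [Function.comp_def] at h
  rw [legSpeed, h]
  simp

lemma contDiff_legSpeed (hF : ContDiff ℝ (⊤ : ℕ∞) F) : ContDiff ℝ (⊤ : ℕ∞) (legSpeed F) := by
  have h1 : ContDiff ℝ (⊤ : ℕ∞) fun z => fderiv ℝ F z (0, 1) :=
    (hF.fderiv_right (m := ((⊤ : ℕ∞) : WithTop ℕ∞)) (by simp)).clm_apply contDiff_const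
  exact h1.fst.inner ℝ hF.snd

lemma contDiffAt_normalize {V : Type*} [NormedAddCommGroup V] [InnerProductSpace ℝ V] {y : V}
    (hy : y ≠ 0) : ContDiffAt ℝ (⊤ : ℕ∞) (fun y : V => ‖y‖⁻¹ • y) y :=
  ((contDiffAt_norm ℝ hy).inv (norm_ne_zero_iff.2 hy)).smul contDiffAt_id

lemma contDiffAt_coneMap (hF : ContDiff ℝ (⊤ : ℕ∞) F) {y : EuclideanSpace ℝ (Fin m)} (hy : y ≠ 0)
    (t : ℝ) : ContDiffAt ℝ (⊤ : ℕ∞) (coneMap F) (y, t) := by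
  have hN : ContDiffAt ℝ (⊤ : ℕ∞)
      (fun z : EuclideanSpace ℝ (Fin m) × ℝ => F (‖z.1‖⁻¹ • z.1, z.2)) (y, t) :=
    hF.contDiffAt.comp (y, t)
      (((contDiffAt_normalize hy).comp (y, t) contDiffAt_fst).prodMk contDiffAt_snd)
  exact hN.fst.prodMk ((((contDiffAt_norm ℝ hy).comp (y, t) contDiffAt_fst)).smul hN.snd)

/-- The derivatives of the norm and of the normalisation map. -/
lemma exists_hasFDerivAt_normalize {V : Type*} [NormedAddCommGroup V] [InnerProductSpace ℝ V]
    {y : V} (hy : y ≠ 0) : ∃ (n : V →L[ℝ] ℝ) (N : V →L[ℝ] V), HasFDerivAt (‖·‖) n y ∧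
      HasFDerivAt (fun y : V => ‖y‖⁻¹ • y) N y ∧ (∀ w, ⟪N w, ‖y‖⁻¹ • y⟫ = 0) ∧
      ∀ w, N w = 0 → n w = 0 → w = 0 := by
  have hn : HasFDerivAt (‖·‖) (fderiv ℝ (‖·‖) y) y :=
    ((contDiffAt_norm ℝ hy (n := 1)).differentiableAt one_ne_zero).hasFDerivAt
  have hN : HasFDerivAt (fun y : V => ‖y‖⁻¹ • y) (fderiv ℝ (fun y : V => ‖y‖⁻¹ • y) y) y :=
    ((contDiffAt_normalize hy).differentiableAt (by simp)).hasFDerivAt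
  refine ⟨_, _, hn, hN, fun w => ?_, fun w hw1 hw2 => ?_⟩
  · have h1 := hN.norm_sq
    have h2 : (fun y : V => ‖‖y‖⁻¹ • y‖ ^ 2) =ᶠ[𝓝 y] fun _ => 1 := by
      filter_upwards [isOpen_ne.mem_nhds hy] with y' hy'
      have : ‖y'‖ ≠ 0 := norm_ne_zero_iff.2 hy'
      simp [norm_smul, this]
    have h3 := congrArg (fun A => A w) (h1.unique ((hasFDerivAt_const 1 y).congr_of_eventuallyEq h2))
    simpa [real_inner_comm, inner_smul_left, inner_smul_right, hy] using h3
  · have h1 := hn.smul hN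
    have h2 : (fun y : V => ‖y‖ • ‖y‖⁻¹ • y) =ᶠ[𝓝 y] id := by
      filter_upwards [isOpen_ne.mem_nhds hy] with y' hy'
      exact smul_inv_smul₀ (norm_ne_zero_iff.2 hy') y'
    have h3 := congrArg (fun A => A w) (h1.unique ((hasFDerivAt_id y).congr_of_eventuallyEq h2))
    simpa [hw1, hw2] using h3.symm

/-- The derivative of the homogeneous extension. -/
lemma fderiv_coneMap (hF : ContDiff ℝ (⊤ : ℕ∞) F) {y : EuclideanSpace ℝ (Fin m)} (t : ℝ)
    {n : EuclideanSpace ℝ (Fin m) →L[ℝ] ℝ}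
    {N : EuclideanSpace ℝ (Fin m) →L[ℝ] EuclideanSpace ℝ (Fin m)} (hn : HasFDerivAt (‖·‖) n y)
    (hN : HasFDerivAt (fun y : EuclideanSpace ℝ (Fin m) => ‖y‖⁻¹ • y) N y)
    (w : EuclideanSpace ℝ (Fin m)) (τ : ℝ) :
    fderiv ℝ (coneMap F) (y, t) (w, τ) =
      ((fderiv ℝ F (‖y‖⁻¹ • y, t) (N w, τ)).1,
        ‖y‖ • (fderiv ℝ F (‖y‖⁻¹ • y, t) (N w, τ)).2 + n w • (F (‖y‖⁻¹ • y, t)).2) := by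
  have hF' : HasFDerivAt F (fderiv ℝ F (‖y‖⁻¹ • y, t)) (‖y‖⁻¹ • y, t) :=
    (hF.differentiable (by simp) _).hasFDerivAt
  have hfst := hasFDerivAt_fst (𝕜 := ℝ) (p := (y, t))
  have hsnd := hasFDerivAt_snd (𝕜 := ℝ) (p := (y, t))
  have h1 := hF'.comp (y, t) ((HasFDerivAt.comp (y, t) hN hfst).prodMk hsnd)
  have h2 := h1.fst.prodMk ((HasFDerivAt.comp (y, t) hn hfst).smul h1.snd)
  have h3 : fderiv ℝ (coneMap F) (y, t) = _ := h2.fderiv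
  rw [h3]
  simp

lemma inner_fderiv_snd_eq_zero (hF : IsLegIsotopyST m F) {y : EuclideanSpace ℝ (Fin m)} (hy : y ≠ 0)
    {t : ℝ} (ht : t ∈ Icc (0 : ℝ) 1)
    {N : EuclideanSpace ℝ (Fin m) →L[ℝ] EuclideanSpace ℝ (Fin m)}
    (hN : HasFDerivAt (fun y : EuclideanSpace ℝ (Fin m) => ‖y‖⁻¹ • y) N y)
    (w : EuclideanSpace ℝ (Fin m)) :
    ⟪(fderiv ℝ F (‖y‖⁻¹ • y, t) (N w, 0)).2, (F (‖y‖⁻¹ • y, t)).2⟫ = 0 := by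
  have hF' : HasFDerivAt F (fderiv ℝ F (‖y‖⁻¹ • y, t)) (‖y‖⁻¹ • y, t) :=
    (hF.smooth.differentiable (by simp) _).hasFDerivAt
  have h1 := (hF'.comp y (hN.prodMk (hasFDerivAt_const t y))).snd.norm_sq
  have h2 : (fun y : EuclideanSpace ℝ (Fin m) => ‖(F (‖y‖⁻¹ • y, t)).2‖ ^ 2) =ᶠ[𝓝 y]
      fun _ => 1 := by
    filter_upwards [isOpen_ne.mem_nhds hy] with y' hy'
    have := hF.mem_sphere _ (normalize_mem_sph hy') t ht
    simp only [sph, mem_sphere_zero_iff_norm] at this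
    simp [this]
  have h3 := congrArg (fun A => A w) (h1.unique ((hasFDerivAt_const 1 y).congr_of_eventuallyEq h2))
  rw [real_inner_comm]
  simpa using h3

lemma fderiv_slice (hF : ContDiff ℝ (⊤ : ℕ∞) F) (s v : EuclideanSpace ℝ (Fin m)) (t : ℝ) :
    fderiv ℝ (fun s' => F (s', t)) s v = fderiv ℝ F (s, t) (v, 0) := by
  have h := ((hF.differentiable (by simp) (s, t)).hasFDerivAt.comp s
    (hasFDerivAt_prodMk_left (𝕜 := ℝ) s t)).fderiv
  simp only [Function.comp_def] at h
  rw [h]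
  simp

lemma IsLegIsotopyST.isConeFamily (hF : IsLegIsotopyST m F) : IsConeFamily (coneMap F) where
  smooth y hy t := contDiffAt_coneMap hF.smooth hy t
  norm_snd y hy t ht := by
    have := hF.mem_sphere _ (normalize_mem_sph hy) t ht
    simp only [sph, mem_sphere_zero_iff_norm] at this
    simp [coneMap, norm_smul, this]
  imm y hy t ht w hw := by
    obtain ⟨n, N, hn, hN, hNy, hw0⟩ := exists_hasFDerivAt_normalize hy
    have hs := normalize_mem_sph hy
    have hq := hF.mem_sphere _ hs t ht
    simp only [sph, mem_sphere_zero_iff_norm] at hq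
    rw [fderiv_coneMap hF.smooth t hn hN, Prod.mk_eq_zero] at hw
    have h1 := inner_fderiv_snd_eq_zero hF hy ht hN w
    have h2 : n w = 0 := by
      have := congrArg (fun u => ⟪u, (F (‖y‖⁻¹ • y, t)).2⟫) hw.2
      simpa [inner_add_left, inner_smul_left, h1, hq] using this
    have h3 : fderiv ℝ F (‖y‖⁻¹ • y, t) (N w, 0) = 0 := by
      refine Prod.ext hw.1 ?_
      have := hw.2
      rw [h2, zero_smul, add_zero, smul_eq_zero] at this
      exact this.resolve_left (norm_ne_zero_iff.2 hy)
    refine hw0 w ?_ h2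
    by_contra hNw
    exact hF.imm t ht _ hs _ (hNy w) hNw ((fderiv_slice hF.smooth _ _ _).trans h3)
  leg y hy t ht w := by
    obtain ⟨n, N, hn, hN, hNy, -⟩ := exists_hasFDerivAt_normalize hy
    have := hF.leg t ht _ (normalize_mem_sph hy) _ (hNy w)
    rw [fderiv_slice hF.smooth] at this
    rw [fderiv_coneMap hF.smooth t hn hN]
    simp [coneMap, inner_smul_right, this]

lemma inner_fderiv_coneMap (hF : ContDiff ℝ (⊤ : ℕ∞) F) {y : EuclideanSpace ℝ (Fin m)} (hy : y ≠ 0)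
    (t : ℝ) : ⟪(fderiv ℝ (coneMap F) (y, t) (0, 1)).1, (coneMap F (y, t)).2⟫ =
      ‖y‖ * legSpeed F (‖y‖⁻¹ • y, t) := by
  obtain ⟨n, N, hn, hN, -, -⟩ := exists_hasFDerivAt_normalize hy
  rw [fderiv_coneMap hF t hn hN]
  simp [coneMap, inner_smul_right, legSpeed]

end ConeMap

section Slices

variable {m : ℕ} {F F' : EuclideanSpace ℝ (Fin m) × ℝ → STSp m}

lemma IsLegIsotopyST.comp_time (hF : IsLegIsotopyST m F) {τ : ℝ → ℝ} (hτ : ContDiff ℝ (⊤ : ℕ∞) τ)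
    (hτI : MapsTo τ (Icc 0 1) (Icc 0 1)) : IsLegIsotopyST m fun z => F (z.1, τ z.2) where
  smooth := hF.smooth.comp (contDiff_fst.prodMk (hτ.comp contDiff_snd))
  mem_sphere s hs _ ht := hF.mem_sphere s hs _ (hτI ht)
  inj _ ht := hF.inj _ (hτI ht)
  imm _ ht := hF.imm _ (hτI ht)
  leg _ ht := hF.leg _ (hτI ht)

lemma legSpeed_comp_time (hF : ContDiff ℝ (⊤ : ℕ∞) F) {τ : ℝ → ℝ} {τ' t : ℝ}
    (hτ : HasDerivAt τ τ' t) (s : EuclideanSpace ℝ (Fin m)) :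
    legSpeed (fun z => F (z.1, τ z.2)) (s, t) = τ' * legSpeed F (s, τ t) := by
  have h1 : HasFDerivAt F (fderiv ℝ F (s, τ t)) (s, τ t) :=
    (hF.differentiable (by simp) _).hasFDerivAt
  have h2 : HasFDerivAt (fun z : EuclideanSpace ℝ (Fin m) × ℝ => (z.1, τ z.2)) _ (s, t) :=
    hasFDerivAt_fst.prodMk (hτ.hasFDerivAt.comp (s, t) hasFDerivAt_snd)
  have h3 : fderiv ℝ (fun z : EuclideanSpace ℝ (Fin m) × ℝ => F (z.1, τ z.2)) (s, t) = _ :=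
    (HasFDerivAt.comp (s, t) h1 h2).fderiv
  rw [legSpeed, h3, legSpeed]
  have h4 : ((0 : EuclideanSpace ℝ (Fin m)), τ') = τ' • (0, 1) := by simp
  simp [h4, -Prod.smul_mk, inner_smul_left]

lemma exists_coneMap_eq {a b : ℝ} (h : stSlice m F a ⊆ stSlice m F' b)
    {y : EuclideanSpace ℝ (Fin m)} (hy : y ≠ 0) : ∃ y' ≠ 0, coneMap F' (y', b) = coneMap F (y, a) := by
  obtain ⟨s, hs, hsF⟩ := h (mem_image_of_mem (fun s => F (s, a)) (normalize_mem_sph hy))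
  have hs1 : ‖s‖ = 1 := by simpa [sph] using hs
  have hs0 : s ≠ 0 := norm_ne_zero_iff.1 (by simp [hs1])
  refine ⟨‖y‖ • s, smul_ne_zero (norm_ne_zero_iff.2 hy) hs0, ?_⟩
  dsimp only at hsF
  have h1 : ‖‖y‖ • s‖ = ‖y‖ := by simp [norm_smul, hs1]
  rw [coneMap, coneMap]
  dsimp only
  rw [h1, inv_smul_smul₀ (norm_ne_zero_iff.2 hy), hsF]

lemma coneMap_fst_of_stSlice_eq_fib {t : ℝ} {x : EuclideanSpace ℝ (Fin m)}
    (h : stSlice m F t = fib m x) {y : EuclideanSpace ℝ (Fin m)} (hy : y ≠ 0) :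
    (coneMap F (y, t)).1 = x := by
  have := h.subset (mem_image_of_mem (fun s => F (s, t)) (normalize_mem_sph hy))
  exact this.1

lemma exists_coneMap_eq_of_stSlice_eq_fib {t : ℝ} {x : EuclideanSpace ℝ (Fin m)}
    (h : stSlice m F t = fib m x) {p : EuclideanSpace ℝ (Fin m)} (hp : p ≠ 0) :
    ∃ y ≠ 0, coneMap F (y, t) = (x, p) := by
  have hslice : stSlice m (fun z => (x, z.1)) t = fib m x := by
    ext z
    simp only [stSlice, fib, mem_image, mem_prod, mem_singleton_iff]
    exact ⟨fun ⟨s, hs, hsz⟩ => hsz ▸ ⟨rfl, hs⟩, fun ⟨h1, h2⟩ => ⟨z.2, h2, Prod.ext h1.symm rfl⟩⟩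
  obtain ⟨y, hy, hyp⟩ := exists_coneMap_eq (hslice.trans h.symm).subset hp
  refine ⟨y, hy, hyp.trans ?_⟩
  simp [coneMap, hp]

end Slices

section Extension

variable {V W : Type*} [NormedAddCommGroup V] [NormedSpace ℝ V] [FiniteDimensional ℝ V]
  [NormedAddCommGroup W] [NormedSpace ℝ W] [FiniteDimensional ℝ W]

lemma exists_contDiffAt_leftInverse {Ψ : V → W} {z : V} (hΨ : ContDiffAt ℝ 2 Ψ z)
    (h : ∀ v, fderiv ℝ Ψ z v = 0 → v = 0) :
    ∃ π : W → V, ContDiffAt ℝ 2 π (Ψ z) ∧ ∀ᶠ v in 𝓝 z, π (Ψ v) = v := by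
  obtain ⟨T, hT⟩ := LinearMap.exists_leftInverse_of_injective
    (fderiv ℝ Ψ z : V →ₗ[ℝ] W) (LinearMap.ker_eq_bot'.2 h)
  let T' : W →L[ℝ] V := LinearMap.toContinuousLinearMap T
  have hd : HasFDerivAt (fun v => T' (Ψ v))
      ((ContinuousLinearEquiv.refl ℝ V : V ≃L[ℝ] V) : V →L[ℝ] V) z := by
    have := T'.hasFDerivAt.comp z (hΨ.differentiableAt two_ne_zero).hasFDerivAt
    have h1 : ((ContinuousLinearEquiv.refl ℝ V : V ≃L[ℝ] V) : V →L[ℝ] V) =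
        T'.comp (fderiv ℝ Ψ z) := by
      ext v
      exact (LinearMap.congr_fun hT v).symm
    rw [h1]
    exact this
  have hc : ContDiffAt ℝ 2 (fun v => T' (Ψ v)) z := T'.contDiff.contDiffAt.comp z hΨ
  have hinv : ContDiffAt ℝ 2 (hc.localInverse hd two_ne_zero) (T' (Ψ z)) :=
    hc.to_localInverse hd two_ne_zero
  exact ⟨fun w => hc.localInverse hd two_ne_zero (T' w), hinv.comp (Ψ z) T'.contDiff.contDiffAt,
    (hc.hasStrictFDerivAt' hd two_ne_zero).eventually_left_inverse⟩

open scoped Manifold in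
/-- A function on an embedded compact set extends to the ambient space. -/
lemma exists_contDiff_extension {Ψ : V → W} {S : Set V} (hS : IsCompact S)
    (hΨ : ∀ z ∈ S, ContDiffAt ℝ 2 Ψ z) (hinj : InjOn Ψ S)
    (himm : ∀ z ∈ S, ∀ v, fderiv ℝ Ψ z v = 0 → v = 0) {g : V → ℝ}
    (hg : ∀ z ∈ S, ContDiffAt ℝ 2 g z) {C : Set ℝ} (hC : Convex ℝ C) (h0 : 0 ∈ C)
    (hgC : ∀ z ∈ S, ∀ᶠ v in 𝓝 z, g v ∈ C) :
    ∃ K : W → ℝ, ContDiff ℝ 2 K ∧ HasCompactSupport K ∧ (∀ z ∈ S, K (Ψ z) = g z) ∧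
      ∀ w, K w ∈ C := by
  have hΨc : ContinuousOn Ψ S := fun z hz => (hΨ z hz).continuousAt.continuousWithinAt
  have hcl : ∀ S' ⊆ S, IsClosed S' → IsClosed (Ψ '' S') := fun S' hS' hcl =>
    ((hS.of_isClosed_subset hcl hS').image_of_continuousOn (hΨc.mono hS')).isClosed
  obtain ⟨k, hk⟩ := exists_contMDiffMap_forall_mem_convex_of_local (n := 2) 𝓘(ℝ, W)
    (t := fun w => {v : ℝ | v ∈ C ∧ ∀ z ∈ S, Ψ z = w → v = g z}) (fun w => by
      refine hC.inter fun v hv v' hv' a b ha hb hab z hz hzw => ?_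
      rw [hv z hz hzw, hv' z hz hzw, ← add_smul, hab, one_smul]) (fun w => by
      by_cases hw : w ∈ Ψ '' S
      · obtain ⟨z, hz, rfl⟩ := hw
        obtain ⟨π, hπ, hπΨ⟩ := exists_contDiffAt_leftInverse (hΨ z hz) (himm z hz)
        have hπz : π (Ψ z) = z := hπΨ.self_of_nhds
        obtain ⟨O, hO, hOo, hzO⟩ := _root_.eventually_nhds_iff.1 hπΨ
        have hgπ : ContDiffAt ℝ 2 (fun w => g (π w)) (Ψ z) := by
          refine ContDiffAt.comp (Ψ z) ?_ hπ
          rw [hπz]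
          exact hg z hz
        have h1 : ∀ᶠ w in 𝓝 (Ψ z), ContDiffAt ℝ 2 (fun w => g (π w)) w :=
          hgπ.eventually (by simp)
        have h2 : ∀ᶠ w in 𝓝 (Ψ z), g (π w) ∈ C := by
          have := hgC z hz
          rw [← hπz] at this
          exact hπ.continuousAt.eventually this
        have h3 : ∀ᶠ w in 𝓝 (Ψ z), w ∉ Ψ '' (S \ O) := by
          refine (hcl _ sdiff_subset (hS.isClosed.sdiff hOo)).isOpen_compl.mem_nhds ?_
          rintro ⟨z', ⟨hz'S, hz'O⟩, hz'⟩
          rw [hinj hz'S hz hz'] at hz'O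
          exact hz'O hzO
        refine ⟨_, (h1.and (h2.and h3)), fun w => g (π w), fun w hw =>
          hw.1.contMDiffAt.contMDiffWithinAt, ?_⟩
        rintro w ⟨-, hwC, hwO⟩
        refine ⟨hwC, ?_⟩
        rintro z' hz' rfl
        have : z' ∈ O := by
          by_contra hz'O
          exact hwO ⟨z', ⟨hz', hz'O⟩, rfl⟩
        dsimp only
        rw [hO z' this]
      · exact ⟨_, (hcl S subset_rfl hS.isClosed).isOpen_compl.mem_nhds hw, fun _ => 0,
          contMDiffOn_const, fun w' hw' => ⟨h0, fun z hz hzw => (hw' ⟨z, hz, hzw⟩).elim⟩⟩)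
  have hcomp : IsCompact (Ψ '' S) := hS.image_of_continuousOn hΨc
  obtain ⟨η, hη, hηc, -, hη1, hηI⟩ := exists_contDiff_cutoff hcomp isOpen_univ (subset_univ _)
  refine ⟨fun w => η w • k w, ?_, hηc.smul_right, fun z hz => ?_, fun w => ?_⟩
  · exact (mod_cast contDiff_infty.1 hη 2 : ContDiff ℝ 2 η).smul k.contMDiff.contDiff
  · have h1 : η (Ψ z) = 1 := subset_of_mem_nhdsSet hη1 (mem_image_of_mem Ψ hz)
    dsimp only
    rw [h1, one_smul]
    exact (hk (Ψ z)).2 z hz rfl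
  · exact hC.smul_mem_of_zero_mem h0 (hk w).1 (hηI w)

end Extension

section Adapted

variable {m : ℕ} {F G G' : EuclideanSpace ℝ (Fin m) × ℝ → STSp m} {K : ℝ × STSp m → ℝ}

/-- A compactly supported time-dependent function on the ambient space whose restriction to the
isotopy is the speed of the isotopy. -/
structure IsAdapted (F : EuclideanSpace ℝ (Fin m) × ℝ → STSp m) (K : ℝ × STSp m → ℝ) : Prop where
  contDiff : ContDiff ℝ 2 K
  hasCompactSupport : HasCompactSupport K
  eq_legSpeed : ∀ s ∈ sph m, ∀ t ∈ Icc (0 : ℝ) 1, K (t, F (s, t)) = legSpeed F (s, t)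

lemma ne_zero_of_mem_sph {s : EuclideanSpace ℝ (Fin m)} (hs : s ∈ sph m) : s ≠ 0 :=
  ne_zero_of_mem_unit_sphere ⟨s, hs⟩

lemma inv_norm_smul_of_mem_sph {s : EuclideanSpace ℝ (Fin m)} (hs : s ∈ sph m) :
    ‖s‖⁻¹ • s = s := by
  have : ‖s‖ = 1 := by simpa [sph] using hs
  rw [this, inv_one, one_smul]

lemma coneMap_of_mem_sph {s : EuclideanSpace ℝ (Fin m)} (hs : s ∈ sph m) (t : ℝ) :
    coneMap F (s, t) = F (s, t) := by
  have : ‖s‖ = 1 := by simpa [sph] using hs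
  simp [coneMap, this]

lemma IsLegIsotopyST.exists_isAdapted (hF : IsLegIsotopyST m F) {C : Set ℝ} (hC : Convex ℝ C)
    (h0 : 0 ∈ C) (hFC : ∀ s ∈ sph m, ∀ t, legSpeed F (s, t) ∈ C) :
    ∃ K, IsAdapted F K ∧ ∀ w, K w ∈ C := by
  set S : Set (EuclideanSpace ℝ (Fin m) × ℝ) := sph m ×ˢ Icc 0 1 with hSdef
  have hS : IsCompact S := (isCompact_sphere _ _).prod isCompact_Icc
  have hSne : ∀ z ∈ S, z.1 ≠ 0 := fun z hz => ne_zero_of_mem_sph hz.1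
  have hcone : ∀ z ∈ S, ContDiffAt ℝ 2 (coneMap F) z := fun z hz =>
    mod_cast contDiffAt_infty.1 (contDiffAt_coneMap hF.smooth (hSne z hz) z.2) 2
  obtain ⟨K, hK, hKc, hKg, hKC⟩ := exists_contDiff_extension (Ψ := fun z => (z.2, coneMap F z)) hS
    (fun z hz => contDiffAt_snd.prodMk (hcone z hz))
    (fun z hz z' hz' h => by
      obtain ⟨s, t⟩ := z
      obtain ⟨s', t'⟩ := z'
      simp only [Prod.mk.injEq] at h
      obtain ⟨rfl, h⟩ := h
      rw [coneMap_of_mem_sph hz.1, coneMap_of_mem_sph hz'.1] at h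
      have hss : s = s' := hF.inj t hz.2 hz.1 hz'.1 h
      rw [hss])
    (fun z hz v hv => by
      have h1 := (hasFDerivAt_snd.prodMk ((hcone z hz).differentiableAt two_ne_zero).hasFDerivAt
        ).fderiv
      rw [h1, ContinuousLinearMap.prod_apply, Prod.mk_eq_zero] at hv
      obtain ⟨w, τ⟩ := v
      obtain ⟨hτ, hw⟩ := hv
      obtain rfl : τ = 0 := hτ
      rw [hF.isConeFamily.imm z.1 (hSne z hz) z.2 hz.2 w hw]
      rfl)
    (g := fun z => legSpeed F (‖z.1‖⁻¹ • z.1, z.2))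
    (fun z hz => by
      have h1 : ContDiffAt ℝ (⊤ : ℕ∞) (fun z => legSpeed F (‖z.1‖⁻¹ • z.1, z.2)) z :=
        (contDiff_legSpeed hF.smooth).contDiffAt.comp z
          (((contDiffAt_normalize (hSne z hz)).comp z contDiffAt_fst).prodMk contDiffAt_snd)
      exact mod_cast contDiffAt_infty.1 h1 2)
    hC h0 (fun z hz => by
      filter_upwards [(isOpen_ne.preimage continuous_fst).mem_nhds (hSne z hz)] with z' hz'
      exact hFC _ (normalize_mem_sph hz') _)
  refine ⟨K, ⟨hK, hKc, fun s hs t ht => ?_⟩, hKC⟩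
  have := hKg (s, t) ⟨hs, ht⟩
  simp only [coneMap_of_mem_sph hs, inv_norm_smul_of_mem_sph hs] at this
  exact this

lemma IsAdapted.reverse (hF : ContDiff ℝ (⊤ : ℕ∞) F) (hK : IsAdapted F K) :
    IsAdapted (fun z => F (z.1, 1 - z.2)) (fun w => -K (1 - w.1, w.2)) where
  contDiff := (hK.contDiff.comp ((contDiff_const.sub contDiff_fst).prodMk contDiff_snd)).neg
  hasCompactSupport := by
    have h1 := hK.hasCompactSupport.comp_homeomorph
      ((Homeomorph.subLeft (1 : ℝ)).prodCongr (Homeomorph.refl (STSp m)))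
    exact h1.neg
  eq_legSpeed s hs t ht := by
    have h1 : HasDerivAt (fun t : ℝ => 1 - t) (-1) t := (hasDerivAt_id t).const_sub 1
    rw [legSpeed_comp_time hF h1,
      ← hK.eq_legSpeed s hs (1 - t) ⟨by linarith [ht.2], by linarith [ht.1]⟩]
    simp

lemma isAdapted_const (hF : ContDiff ℝ (⊤ : ℕ∞) F) : IsAdapted (fun z => F (z.1, 0)) 0 where
  contDiff := contDiff_const
  hasCompactSupport := HasCompactSupport.zero
  eq_legSpeed s _ t _ := by
    rw [legSpeed_comp_time hF (hasDerivAt_const t (0 : ℝ))]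
    simp

/-- The isotopies of the components of a link extend to a common ambient isotopy. -/
lemma exists_isAdapted_link (hG : IsLegIsotopyST m G) (hG' : IsLegIsotopyST m G')
    (hdisj : ∀ t ∈ Icc (0 : ℝ) 1, stSlice m G t ∩ stSlice m G' t = ∅) :
    ∃ K, IsAdapted G K ∧ IsAdapted G' K := by
  obtain ⟨K, hK, -⟩ := hG.exists_isAdapted convex_univ (mem_univ _) fun _ _ _ => mem_univ _
  obtain ⟨K', hK', -⟩ := hG'.exists_isAdapted convex_univ (mem_univ _) fun _ _ _ => mem_univ _
  have hcomp : ∀ {F : EuclideanSpace ℝ (Fin m) × ℝ → STSp m}, IsLegIsotopyST m F →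
      IsCompact ((fun z : EuclideanSpace ℝ (Fin m) × ℝ => (z.2, F z)) '' sph m ×ˢ Icc 0 1) :=
    fun hF => ((isCompact_sphere _ _).prod isCompact_Icc).image
      (continuous_snd.prodMk hF.smooth.continuous)
  obtain ⟨χ, hχ, hχc, hχs, hχ1, -⟩ := exists_contDiff_cutoff (hcomp hG)
    (hcomp hG').isClosed.isOpen_compl (by
      rintro _ ⟨⟨s, t⟩, ⟨hs, ht⟩, rfl⟩ ⟨⟨s', t'⟩, ⟨hs', -⟩, h⟩
      simp only [Prod.mk.injEq] at h
      obtain ⟨rfl, h⟩ := h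
      have h2 : G (s, t') ∈ stSlice m G t' ∩ stSlice m G' t' :=
        ⟨⟨s, hs, rfl⟩, ⟨s', hs', h⟩⟩
      rw [hdisj t' ht] at h2
      exact h2)
  have hχ2 : ContDiff ℝ 2 χ := mod_cast contDiff_infty.1 hχ 2
  have hcd : ContDiff ℝ 2 fun w => χ w * K w + (1 - χ w) * K' w :=
    (hχ2.mul hK.contDiff).add ((contDiff_const.sub hχ2).mul hK'.contDiff)
  have hcs : HasCompactSupport fun w => χ w * K w + (1 - χ w) * K' w :=
    hχc.mul_right.add hK'.hasCompactSupport.mul_left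
  refine ⟨_, ⟨hcd, hcs, fun s hs t ht => ?_⟩, ⟨hcd, hcs, fun s hs t ht => ?_⟩⟩
  · have h1 : χ (t, G (s, t)) = 1 :=
      subset_of_mem_nhdsSet hχ1 (mem_image_of_mem _ (mk_mem_prod hs ht))
    simp only [h1, one_mul, sub_self, zero_mul, add_zero]
    exact hK.eq_legSpeed s hs t ht
  · have h1 : χ (t, G' (s, t)) = 0 := image_eq_zero_of_notMem_tsupport fun h =>
      hχs h (mem_image_of_mem _ (mk_mem_prod hs ht))
    simp only [h1, sub_zero, one_mul, zero_mul, zero_add]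
    exact hK'.eq_legSpeed s hs t ht

end Adapted

section Hamiltonian

variable {E : Type*} [NormedAddCommGroup E] [InnerProductSpace ℝ E] {χ : E → ℝ}
  {K : ℝ × (E × E) → ℝ} {a b : ℝ}

/-- The positively homogeneous extension of `K` in the second component, cut off by `χ`. -/
def coneHam (χ : E → ℝ) (K : ℝ × (E × E) → ℝ) (w : ℝ × (E × E)) : ℝ :=
  χ w.2.2 * (‖w.2.2‖ * K (w.1, w.2.1, ‖w.2.2‖⁻¹ • w.2.2))

/-- A cutoff function which is identically one on an annulus and vanishes near zero. -/
structure IsAnnularCutoff (a b : ℝ) (χ : E → ℝ) : Prop where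
  contDiff : ContDiff ℝ 2 χ
  hasCompactSupport : HasCompactSupport χ
  ne_zero : ∀ p ∈ tsupport χ, p ≠ 0
  eventually_eq_one : ∀ p, a ≤ ‖p‖ → ‖p‖ ≤ b → ∀ᶠ p' in 𝓝 p, χ p' = 1
  mem_Icc : ∀ p, χ p ∈ Icc (0 : ℝ) 1

lemma exists_isAnnularCutoff [FiniteDimensional ℝ E] (ha : 0 < a) (b : ℝ) :
    ∃ χ : E → ℝ, IsAnnularCutoff a b χ := by
  have hK : IsCompact {p : E | a ≤ ‖p‖ ∧ ‖p‖ ≤ b} := by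
    have := (isCompact_annulus_prod (E := E) a b).image continuous_fst
    rwa [fst_image_prod _ ⟨0, by simp⟩] at this
  obtain ⟨χ, hχ, hχc, hχs, hχ1, hχI⟩ := exists_contDiff_cutoff hK isOpen_ne (fun p hp h0 => by
    rw [h0, mem_ofPred_eq, norm_zero] at hp
    linarith [hp.1] : _ ⊆ {p : E | p ≠ 0})
  exact ⟨χ, mod_cast contDiff_infty.1 hχ 2, hχc, hχs,
    fun p h1 h2 => eventually_nhdsSet_iff_forall.1 hχ1 p ⟨h1, h2⟩, hχI⟩

lemma coneHam_mono (hχ : IsAnnularCutoff a b χ) {K' : ℝ × (E × E) → ℝ} (h : ∀ w, K w ≤ K' w)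
    (w : ℝ × (E × E)) : coneHam χ K w ≤ coneHam χ K' w := by
  rw [coneHam, coneHam]
  have := (hχ.mem_Icc w.2.2).1
  gcongr
  exact h _

lemma contDiff_coneHam (hχ : IsAnnularCutoff a b χ) (hK : ContDiff ℝ 2 K) :
    ContDiff ℝ 2 (coneHam χ K) := by
  refine contDiff_iff_contDiffAt.2 fun w => ?_
  have hχ2 : ContDiff ℝ 2 fun w : ℝ × (E × E) => χ w.2.2 :=
    hχ.contDiff.comp (contDiff_snd.comp contDiff_snd)
  by_cases hw : w.2.2 ∈ tsupport χ
  · have hp := hχ.ne_zero _ hw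
    have h1 : ContDiffAt ℝ 2 (fun w : ℝ × (E × E) => w.2.2) w :=
      (contDiff_snd.comp contDiff_snd).contDiffAt
    have h2 : ContDiffAt ℝ 2 (fun w : ℝ × (E × E) => ‖w.2.2‖⁻¹ • w.2.2) w :=
      (((h1.norm ℝ hp).inv (norm_ne_zero_iff.2 hp))).smul h1
    exact hχ2.contDiffAt.mul ((h1.norm ℝ hp).mul (hK.contDiffAt.comp w
      (contDiffAt_fst.prodMk ((contDiff_fst.comp contDiff_snd).contDiffAt.prodMk h2))))
  · refine (contDiffAt_const (c := (0 : ℝ))).congr_of_eventuallyEq ?_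
    have h1 : Continuous fun w : ℝ × (E × E) => w.2.2 := continuous_snd.comp continuous_snd
    filter_upwards [((isClosed_tsupport χ).isOpen_compl.preimage h1).mem_nhds hw] with w' hw'
    rw [coneHam, image_eq_zero_of_notMem_tsupport hw', zero_mul]

lemma hasCompactSupport_coneHam (hχ : IsAnnularCutoff a b χ) (hK : HasCompactSupport K) :
    HasCompactSupport (coneHam χ K) := by
  have h1 : IsCompact (Prod.fst '' tsupport K) := hK.isCompact.image continuous_fst
  have h2 : IsCompact ((fun w => w.2.1) '' tsupport K) :=
    hK.isCompact.image (continuous_fst.comp continuous_snd)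
  refine .of_support_subset_isCompact (h1.prod (h2.prod hχ.hasCompactSupport.isCompact)) ?_
  intro w hw
  rw [Function.mem_support, coneHam] at hw
  have hχw := left_ne_zero_of_mul hw
  have hKw := right_ne_zero_of_mul (right_ne_zero_of_mul hw)
  have hKs := subset_tsupport K hKw
  exact ⟨⟨_, hKs, rfl⟩, ⟨_, hKs, rfl⟩, subset_tsupport χ hχw⟩

variable [FiniteDimensional ℝ E]

lemma norm_gradFst_coneHam_le (hχ : IsAnnularCutoff a b χ) (hK : ContDiff ℝ 2 K) {C : ℝ}
    (hC : ∀ w, ‖fderiv ℝ K w‖ ≤ C) (t : ℝ) (z : E × E) :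
    ‖gradFst (fun z => coneHam χ K (t, z)) z‖ ≤ C * ‖z.2‖ := by
  obtain ⟨x, p⟩ := z
  have hH : ContDiff ℝ 2 fun z => coneHam χ K (t, z) :=
    (contDiff_coneHam hχ hK).comp (contDiff_const.prodMk contDiff_id)
  have h1 : fderiv ℝ (fun x' => coneHam χ K (t, (x', p))) x =
      (fderiv ℝ (fun z => coneHam χ K (t, z)) (x, p)).comp (.inl ℝ E E) :=
    (HasFDerivAt.comp (g := fun z => coneHam χ K (t, z)) x
      (hH.differentiable two_ne_zero (x, p)).hasFDerivAt
      (hasFDerivAt_prodMk_left (𝕜 := ℝ) x p)).fderiv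
  have h2 : fderiv ℝ (fun x' => coneHam χ K (t, (x', p))) x = (χ p * ‖p‖) •
      (fderiv ℝ K (t, x, ‖p‖⁻¹ • p)).comp ((ContinuousLinearMap.inr ℝ ℝ (E × E)).comp
        (.inl ℝ E E)) := by
    have hKd : HasFDerivAt (fun x' => K (t, x', ‖p‖⁻¹ • p)) _ x :=
      HasFDerivAt.comp x (hK.differentiable two_ne_zero (t, x, ‖p‖⁻¹ • p)).hasFDerivAt
        ((hasFDerivAt_prodMk_right (𝕜 := ℝ) t (x, ‖p‖⁻¹ • p)).comp x
          (hasFDerivAt_prodMk_left (𝕜 := ℝ) x (‖p‖⁻¹ • p)))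
    have := (hKd.const_mul (χ p * ‖p‖)).fderiv
    simpa only [coneHam, mul_assoc] using this
  rw [gradFst, LinearIsometryEquiv.norm_map, ← h1, h2, norm_smul, norm_mul, norm_norm, mul_comm C]
  have h3 : ‖χ p‖ ≤ 1 := by
    rw [Real.norm_of_nonneg (hχ.mem_Icc p).1]
    exact (hχ.mem_Icc p).2
  refine mul_le_mul (mul_le_of_le_one_left (norm_nonneg _) h3) ?_ (norm_nonneg _) (norm_nonneg _)
  refine (ContinuousLinearMap.opNorm_comp_le _ _).trans
    ((mul_le_of_le_one_right (norm_nonneg _) ?_).trans (hC _))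
  exact (ContinuousLinearMap.opNorm_comp_le _ _).trans (mul_le_one₀
    (ContinuousLinearMap.norm_inr_le_one ℝ ℝ (E × E)) (norm_nonneg _)
    (ContinuousLinearMap.norm_inl_le_one ℝ E E))

/-- Euler's identity. -/
lemma inner_gradSnd_coneHam (hχ : IsAnnularCutoff a b χ) (ha : 0 < a) (hK : ContDiff ℝ 2 K) (t : ℝ)
    (x : E) {p : E} (hap : a ≤ ‖p‖) (hpb : ‖p‖ ≤ b) :
    ⟪p, gradSnd (fun z => coneHam χ K (t, z)) (x, p)⟫ = coneHam χ K (t, (x, p)) := by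
  have hH : ContDiff ℝ 2 fun z => coneHam χ K (t, z) :=
    (contDiff_coneHam hχ hK).comp (contDiff_const.prodMk contDiff_id)
  have hp : ‖p‖ ≠ 0 := by linarith
  have hray : HasDerivAt (fun r : ℝ => (x, r • p)) (0, p) 1 := by
    have := (hasDerivAt_id (1 : ℝ)).smul_const p
    rw [one_smul] at this
    exact (hasDerivAt_const (1 : ℝ) x).prodMk this
  have h1 : HasDerivAt (fun r : ℝ => coneHam χ K (t, (x, r • p)))
      (fderiv ℝ (fun z => coneHam χ K (t, z)) (x, p) (0, p)) 1 := by
    have h := (hH.differentiable two_ne_zero (x, (1 : ℝ) • p)).hasFDerivAt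
    rw [one_smul] at h
    exact HasFDerivAt.comp_hasDerivAt_of_eq (1 : ℝ) h hray (by rw [one_smul])
  have h2 : (fun r : ℝ => coneHam χ K (t, (x, r • p))) =ᶠ[𝓝 1]
      fun r => r * coneHam χ K (t, (x, p)) := by
    have hχ1 := (hχ.eventually_eq_one p hap hpb).self_of_nhds
    have hcont : Filter.Tendsto (fun r : ℝ => r • p) (𝓝 1) (𝓝 p) := by
      have : Continuous fun r : ℝ => r • p := by fun_prop
      simpa using this.tendsto 1
    filter_upwards [hcont.eventually (hχ.eventually_eq_one p hap hpb),
      lt_mem_nhds (zero_lt_one' ℝ)] with r hr hr0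
    have hn : ‖r • p‖⁻¹ • r • p = ‖p‖⁻¹ • p := by
      rw [norm_smul, Real.norm_of_nonneg hr0.le, smul_smul]
      congr 1
      field_simp
    simp only [coneHam, hr, hχ1, hn]
    rw [norm_smul, Real.norm_of_nonneg hr0.le]
    ring
  have h3 := ((hasDerivAt_id (1 : ℝ)).mul_const (coneHam χ K (t, (x, p)))).congr_of_eventuallyEq h2
  have h4 := h1.unique h3
  rw [one_mul, fderiv_eq_inner_grad] at h4
  rw [← h4, inner_zero_right, zero_add, real_inner_comm]

end Hamiltonian

lemma coneHam_coneMap {m : ℕ} {F : EuclideanSpace ℝ (Fin m) × ℝ → STSp m} {K : ℝ × STSp m → ℝ}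
    {χ : EuclideanSpace ℝ (Fin m) → ℝ} {a b : ℝ} (hχ : IsAnnularCutoff a b χ)
    (hF : IsLegIsotopyST m F) (hK : IsAdapted F K) {t : ℝ} (ht : t ∈ Icc (0 : ℝ) 1)
    {y : EuclideanSpace ℝ (Fin m)} (hy : y ≠ 0) (hay : a ≤ ‖y‖) (hyb : ‖y‖ ≤ b) :
    coneHam χ K (t, coneMap F (y, t)) =
      ⟪(fderiv ℝ (coneMap F) (y, t) (0, 1)).1, (coneMap F (y, t)).2⟫ := by
  rw [inner_fderiv_coneMap hF.smooth hy, ← hK.eq_legSpeed _ (normalize_mem_sph hy) t ht]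
  have h1 : ‖(coneMap F (y, t)).2‖ = ‖y‖ := hF.isConeFamily.norm_snd y hy t ht
  have h2 : χ (coneMap F (y, t)).2 = 1 :=
    (hχ.eventually_eq_one _ (by rwa [h1]) (by rwa [h1])).self_of_nhds
  rw [coneHam]
  dsimp only
  rw [h1, h2, one_mul]
  congr 3
  simp only [coneMap]
  rw [inv_smul_smul₀ (norm_ne_zero_iff.2 hy)]

section Blocks

variable {E : Type*} [NormedAddCommGroup E] [InnerProductSpace ℝ E]

lemma gradFst_const_mul [FiniteDimensional ℝ E] {f : E × E → ℝ} {z : E × E}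
    (hf : DifferentiableAt ℝ f z) (c : ℝ) :
    gradFst (fun z => c * f z) z = c • gradFst f z := by
  rw [gradFst, gradFst, fderiv_const_mul hf, ContinuousLinearMap.smul_comp, map_smulₛₗ]
  rfl

lemma gradSnd_const_mul [FiniteDimensional ℝ E] {f : E × E → ℝ} {z : E × E}
    (hf : DifferentiableAt ℝ f z) (c : ℝ) :
    gradSnd (fun z => c * f z) z = c • gradSnd f z := by
  rw [gradSnd, gradSnd, fderiv_const_mul hf, ContinuousLinearMap.smul_comp, map_smulₛₗ]
  rfl

omit [InnerProductSpace ℝ E] in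
lemma norm_bounds_of_norm_sub_le {p : ℕ → E} {c : ℝ} (hc0 : 0 ≤ c) (hc : c ≤ 1 / 2) {n : ℕ}
    (hp : ∀ i < n, ‖p i - p (i + 1)‖ ≤ c * ‖p (i + 1)‖) (hpn : ‖p n‖ = 1) {i : ℕ} (hi : i ≤ n) :
    Real.exp (-(2 * (c * n))) ≤ ‖p i‖ ∧ ‖p i‖ ≤ Real.exp (c * n) := by
  have key : ∀ j ≤ n, Real.exp (-(2 * (c * j))) ≤ ‖p (n - j)‖ ∧ ‖p (n - j)‖ ≤ Real.exp (c * j) := by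
    intro j
    induction j with
    | zero => simp [hpn]
    | succ j ih =>
      intro hj
      obtain ⟨ih1, ih2⟩ := ih (by omega)
      have hstep := hp (n - (j + 1)) (by omega)
      rw [show n - (j + 1) + 1 = n - j by omega] at hstep
      have h1 : (1 - c) * ‖p (n - j)‖ ≤ ‖p (n - (j + 1))‖ := by
        have := norm_sub_norm_le (p (n - j)) (p (n - (j + 1)))
        rw [norm_sub_rev] at this
        linarith
      have h2 : ‖p (n - (j + 1))‖ ≤ (1 + c) * ‖p (n - j)‖ := by
        have := norm_sub_norm_le (p (n - (j + 1))) (p (n - j))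
        linarith
      have h3 : Real.exp (-(2 * c)) ≤ 1 - c := by
        rw [Real.exp_neg]
        refine inv_le_of_inv_le₀ (by linarith) ?_
        refine le_trans ?_ (Real.add_one_le_exp (2 * c))
        rw [inv_le_iff_one_le_mul₀ (by linarith)]
        nlinarith
      have h4 : 1 + c ≤ Real.exp c := by
        rw [add_comm]
        exact Real.add_one_le_exp c
      constructor
      · calc Real.exp (-(2 * (c * (j + 1 : ℕ)))) =
              Real.exp (-(2 * c)) * Real.exp (-(2 * (c * j))) := by
                rw [← Real.exp_add]; push_cast; ring_nf
          _ ≤ (1 - c) * ‖p (n - j)‖ := by gcongr; linarith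
          _ ≤ _ := h1
      · calc _ ≤ (1 + c) * ‖p (n - j)‖ := h2
          _ ≤ Real.exp c * Real.exp (c * j) := by gcongr
          _ = _ := by rw [← Real.exp_add]; push_cast; ring_nf
  have hj : n - i ≤ n := Nat.sub_le _ _
  obtain ⟨h1, h2⟩ := key (n - i) hj
  rw [show n - (n - i) = i by omega] at h1 h2
  have hcast : ((n - i : ℕ) : ℝ) ≤ n := by exact_mod_cast hj
  exact ⟨le_trans (by gcongr) h1, h2.trans (by gcongr)⟩

/-- A discrete orbit through finitely many blocks of steps follows a chain of families of cones. -/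
lemma exists_tracking_chain [FiniteDimensional ℝ E] {Φ : ℕ → E × ℝ → E × E}
    {H : ℕ → ℝ × (E × E) → ℝ} (hΦ : ∀ k, IsConeFamily (Φ k)) (hH : ∀ k, ContDiff ℝ 2 (H k))
    (hHc : ∀ k, HasCompactSupport (H k)) {a b : ℝ} (ha : 0 < a) (hab : a ≤ b)
    (hHΦ : ∀ k, ∀ t ∈ Icc (0 : ℝ) 1, ∀ y, a / 4 < ‖y‖ → ‖y‖ < 4 * b →
      H k (t, Φ k (y, t)) = ⟪(fderiv ℝ (Φ k) (y, t) (0, 1)).1, (Φ k (y, t)).2⟫) (r : ℕ)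
    (hchain : ∀ k < r, ∀ y ≠ 0, ∃ y' ≠ 0, Φ (k + 1) (y', 0) = Φ k (y, 1)) :
    ∃ D ≥ 0, ∃ N₀ : ℕ, ∀ N : ℕ, N₀ ≤ N → 0 < N → ∀ xs ps : ℕ → E,
      (∀ i < (r + 1) * N, xs (i + 1) = xs i + (N : ℝ)⁻¹ •
        gradSnd (fun z => H (i / N) ((i % N : ℕ) * (N : ℝ)⁻¹, z)) (xs i, ps (i + 1))) →
      (∀ i < (r + 1) * N, ps i = ps (i + 1) + (N : ℝ)⁻¹ •
        gradFst (fun z => H (i / N) ((i % N : ℕ) * (N : ℝ)⁻¹, z)) (xs i, ps (i + 1))) →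
      (∀ i ≤ (r + 1) * N, a ≤ ‖ps i‖ ∧ ‖ps i‖ ≤ b) →
      (∃ y ≠ 0, Φ 0 (y, 0) = (xs 0, ps 0)) →
      ∃ y ≠ 0, ‖(xs ((r + 1) * N), ps ((r + 1) * N)) - Φ r (y, 1)‖ ≤ D * (N : ℝ)⁻¹ := by
  have hblock : ∀ {N : ℕ} (k i : ℕ), i < N → (k * N + i) / N = k ∧ (k * N + i) % N = i := by
    intro N k i hi
    exact ⟨by rw [mul_comm, Nat.mul_add_div (by omega), Nat.div_eq_of_lt hi, add_zero],
      Nat.mul_add_mod_of_lt hi⟩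
  induction r with
  | zero =>
    obtain ⟨D, hD, N₀, h⟩ := (hΦ 0).exists_tracking (hH 0) (hHc 0) ha hab (hHΦ 0) le_rfl
    refine ⟨D, hD, N₀, fun N hN hN0 xs ps hx hp hps ⟨y, hy, hyx⟩ => ?_⟩
    rw [zero_add, one_mul] at *
    refine h N hN hN0 xs ps (fun i hi => ?_) (fun i hi => ?_) hps ⟨y, hy, by simp [hyx]⟩
    · simpa only [Nat.div_eq_of_lt hi, Nat.mod_eq_of_lt hi] using hx i hi
    · simpa only [Nat.div_eq_of_lt hi, Nat.mod_eq_of_lt hi] using hp i hi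
  | succ r ih =>
    obtain ⟨D, hD, N₀, h⟩ := ih fun k hk => hchain k (by omega)
    obtain ⟨D', hD', N₀', h'⟩ := (hΦ (r + 1)).exists_tracking (hH _) (hHc _) ha hab (hHΦ _) hD
    refine ⟨D', hD', max N₀ N₀', fun N hN hN0 xs ps hx hp hps hstart => ?_⟩
    have hle : (r + 1 + 1) * N = (r + 1) * N + N := by ring
    rw [hle] at hx hp hps ⊢
    obtain ⟨y, hy, hyd⟩ := h N ((le_max_left _ _).trans hN) hN0 xs ps
      (fun i hi => hx i (by omega)) (fun i hi => hp i (by omega))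
      (fun i hi => hps i (by omega)) hstart
    obtain ⟨y', hy', hyy⟩ := hchain r (by omega) y hy
    rw [← hyy] at hyd
    refine h' N ((le_max_right _ _).trans hN) hN0 (fun i => xs ((r + 1) * N + i))
      (fun i => ps ((r + 1) * N + i)) (fun i hi => ?_) (fun i hi => ?_)
      (fun i hi => hps _ (by omega)) ⟨y', hy', hyd⟩
    · have := hx ((r + 1) * N + i) (by omega)
      rwa [(hblock (r + 1) i hi).1, (hblock (r + 1) i hi).2] at this
    · have := hp ((r + 1) * N + i) (by omega)
      rwa [(hblock (r + 1) i hi).1, (hblock (r + 1) i hi).2] at this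

end Blocks

section Comparison

variable {m : ℕ} {Fs Fs' : ℕ → EuclideanSpace ℝ (Fin m) × ℝ → STSp m}
  {Ks Ks' : ℕ → ℝ × STSp m → ℝ} {r : ℕ} {x y y' : EuclideanSpace ℝ (Fin m)}

/-- Isotopies which lead successively from the fibre over `x` to the fibre over `y`, each of them
generated by a Hamiltonian. -/
structure IsAdaptedChain (Fs : ℕ → EuclideanSpace ℝ (Fin m) × ℝ → STSp m)
    (Ks : ℕ → ℝ × STSp m → ℝ) (r : ℕ) (x y : EuclideanSpace ℝ (Fin m)) : Prop where
  isLegIsotopy : ∀ k, IsLegIsotopyST m (Fs k)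
  isAdapted : ∀ k, IsAdapted (Fs k) (Ks k)
  start : stSlice m (Fs 0) 0 = fib m x
  chain : ∀ k < r, stSlice m (Fs k) 1 ⊆ stSlice m (Fs (k + 1)) 0
  finish : stSlice m (Fs r) 1 = fib m y

lemma IsAdaptedChain.exists_fderiv_bound (h : IsAdaptedChain Fs Ks r x y) :
    ∃ C, 0 ≤ C ∧ ∀ k ≤ r, ∀ w, ‖fderiv ℝ (Ks k) w‖ ≤ C := by
  choose M L hM0 _ hM _ using fun k =>
    exists_fderiv_bounds (h.isAdapted k).contDiff (h.isAdapted k).hasCompactSupport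
  refine ⟨∑ k ∈ Finset.range (r + 1), M k, Finset.sum_nonneg fun k _ => hM0 k,
    fun k hk w => (hM k w).trans ?_⟩
  exact Finset.single_le_sum (f := M) (fun k _ => hM0 k) (Finset.mem_range.2 (by omega))

/-- The generating function of the step `i` of a discretization of the flows of the Hamiltonians
`Ks`, each of which is run through in `N` steps. -/
def stepHam (χ : EuclideanSpace ℝ (Fin m) → ℝ) (Ks : ℕ → ℝ × STSp m → ℝ) (N i : ℕ)
    (z : EuclideanSpace ℝ (Fin m) × EuclideanSpace ℝ (Fin m)) : ℝ :=
  (N : ℝ)⁻¹ * coneHam χ (Ks (i / N)) ((i % N : ℕ) * (N : ℝ)⁻¹, z)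

variable {χ : EuclideanSpace ℝ (Fin m) → ℝ} {a b : ℝ}

lemma contDiff_coneHam_slice {K : ℝ × STSp m → ℝ} (hχ : IsAnnularCutoff a b χ)
    (hK : ContDiff ℝ 2 K) (t : ℝ) :
    ContDiff ℝ 2 fun z : EuclideanSpace ℝ (Fin m) × EuclideanSpace ℝ (Fin m) =>
      coneHam χ K (t, z) :=
  (contDiff_coneHam hχ hK).comp (contDiff_const.prodMk contDiff_id)

lemma contDiff_stepHam (hχ : IsAnnularCutoff a b χ) (hK : ∀ k, ContDiff ℝ 2 (Ks k)) (N i : ℕ) :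
    ContDiff ℝ 2 (stepHam χ Ks N i) :=
  contDiff_const.mul (contDiff_coneHam_slice hχ (hK _) _)

lemma hasCompactSupport_stepHam (hχ : IsAnnularCutoff a b χ) (hK : ∀ k, HasCompactSupport (Ks k))
    (N i : ℕ) : HasCompactSupport (stepHam χ Ks N i) := by
  refine HasCompactSupport.mul_left (.of_support_subset_isCompact
    ((hasCompactSupport_coneHam hχ (hK (i / N))).isCompact.image continuous_snd) fun z hz => ?_)
  exact ⟨_, subset_tsupport _ hz, rfl⟩

lemma gradFst_stepHam (hχ : IsAnnularCutoff a b χ) (hK : ∀ k, ContDiff ℝ 2 (Ks k)) (N i : ℕ)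
    (z : EuclideanSpace ℝ (Fin m) × EuclideanSpace ℝ (Fin m)) :
    gradFst (stepHam χ Ks N i) z = (N : ℝ)⁻¹ •
      gradFst (fun z => coneHam χ (Ks (i / N)) ((i % N : ℕ) * (N : ℝ)⁻¹, z)) z :=
  gradFst_const_mul ((contDiff_coneHam_slice hχ (hK _) _).differentiable two_ne_zero z) _

lemma gradSnd_stepHam (hχ : IsAnnularCutoff a b χ) (hK : ∀ k, ContDiff ℝ 2 (Ks k)) (N i : ℕ)
    (z : EuclideanSpace ℝ (Fin m) × EuclideanSpace ℝ (Fin m)) :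
    gradSnd (stepHam χ Ks N i) z = (N : ℝ)⁻¹ •
      gradSnd (fun z => coneHam χ (Ks (i / N)) ((i % N : ℕ) * (N : ℝ)⁻¹, z)) z :=
  gradSnd_const_mul ((contDiff_coneHam_slice hχ (hK _) _).differentiable two_ne_zero z) _

/-- The discrete orbits which start in the fibre over `x` end close to the fibre over `y`, and
there is no contribution of the steps to their action. -/
lemma IsAdaptedChain.exists_forall_isDiscreteOrbit (h : IsAdaptedChain Fs Ks r x y) {C : ℝ}
    (hC0 : 0 ≤ C) (hC : ∀ k ≤ r, ∀ w, ‖fderiv ℝ (Ks k) w‖ ≤ C)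
    (hχ : IsAnnularCutoff (Real.exp (-(2 * (C * (r + 1)))) / 4) (4 * Real.exp (C * (r + 1))) χ) :
    ∃ D : ℝ, ∃ N₀ : ℕ, ∀ N : ℕ, N₀ ≤ N → 0 < N → ∀ q xs ps, ‖q‖ = 1 →
      IsDiscreteOrbit (stepHam χ Ks N) ((r + 1) * N) x q xs ps →
        ‖xs ((r + 1) * N) - y‖ ≤ D * (N : ℝ)⁻¹ ∧ ∀ i < (r + 1) * N,
          stepHam χ Ks N i (xs i, ps (i + 1)) -
            ⟪ps (i + 1), gradSnd (stepHam χ Ks N i) (xs i, ps (i + 1))⟫ = 0 := by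
  set a := Real.exp (-(2 * (C * (r + 1)))) with ha
  set b := Real.exp (C * (r + 1)) with hb
  have ha0 : 0 < a := Real.exp_pos _
  have hb0 : 0 < b := Real.exp_pos _
  have hCr : 0 ≤ C * (r + 1) := by positivity
  have hab : a ≤ b := Real.exp_le_exp.2 (by linarith)
  have hK2 k := (h.isAdapted k).contDiff
  have hKc k := (h.isAdapted k).hasCompactSupport
  obtain ⟨D, -, N₀, hD⟩ := exists_tracking_chain (fun k => (h.isLegIsotopy k).isConeFamily)
    (fun k => contDiff_coneHam hχ (hK2 k)) (fun k => hasCompactSupport_coneHam hχ (hKc k)) ha0 hab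
    (fun k t ht y hay hyb => coneHam_coneMap hχ (h.isLegIsotopy k) (h.isAdapted k) ht
      (norm_pos_iff.1 (by linarith)) hay.le hyb.le) r
    (fun k hk y hy => exists_coneMap_eq (h.chain k hk) hy)
  refine ⟨D, max N₀ ⌈2 * C⌉₊, fun N hN hN0 q xs ps hq horb => ?_⟩
  have hN0' : (0 : ℝ) < N := mod_cast hN0
  have hc : (N : ℝ)⁻¹ * C ≤ 1 / 2 := by
    have : 2 * C ≤ N := Nat.ceil_le.1 ((le_max_right _ _).trans hN)
    rw [inv_mul_le_iff₀ hN0']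
    linarith
  have hcn : (N : ℝ)⁻¹ * C * ((r + 1) * N : ℕ) = C * (r + 1) := by
    push_cast
    field_simp
  have hps : ∀ i ≤ (r + 1) * N, a ≤ ‖ps i‖ ∧ ‖ps i‖ ≤ b := by
    intro i hi
    rw [ha, hb, ← hcn]
    refine norm_bounds_of_norm_sub_le (by positivity) hc (fun i hi => ?_)
      (by rw [horb.finish, hq]) hi
    have hir : i / N ≤ r := Nat.lt_succ_iff.1 ((Nat.div_lt_iff_lt_mul hN0).2 hi)
    rw [horb.step_snd i hi, add_sub_cancel_left, gradFst_stepHam hχ hK2, norm_smul,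
      Real.norm_of_nonneg (by positivity), mul_assoc]
    gcongr
    exact norm_gradFst_coneHam_le hχ (hK2 _) (hC _ hir) _ _
  have hp0 : ps 0 ≠ 0 := norm_pos_iff.1 (ha0.trans_le (hps 0 (Nat.zero_le _)).1)
  obtain ⟨y₁, hy₁, hy₁d⟩ := hD N ((le_max_left _ _).trans hN) hN0 xs ps
    (fun i hi => by rw [← gradSnd_stepHam hχ hK2]; exact horb.step_fst i hi)
    (fun i hi => by rw [← gradFst_stepHam hχ hK2]; exact horb.step_snd i hi) hps
    (by rw [horb.start]; exact exists_coneMap_eq_of_stSlice_eq_fib h.start hp0)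
  refine ⟨?_, fun i hi => ?_⟩
  · rw [← coneMap_fst_of_stSlice_eq_fib h.finish hy₁]
    exact (norm_fst_le _).trans hy₁d
  · obtain ⟨h1, h2⟩ := hps (i + 1) hi
    rw [gradSnd_stepHam hχ hK2, inner_smul_right,
      inner_gradSnd_coneHam hχ (by positivity) (hK2 _) _ _ (by linarith) (by linarith), stepHam,
      sub_self]

/-- A larger Hamiltonian moves a fibre further in every direction. -/
theorem IsAdaptedChain.inner_le (h : IsAdaptedChain Fs Ks r x y)
    (h' : IsAdaptedChain Fs' Ks' r x y') (hle : ∀ k w, Ks k w ≤ Ks' k w)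
    {q : EuclideanSpace ℝ (Fin m)} (hq : ‖q‖ = 1) : ⟪q, y⟫ ≤ ⟪q, y'⟫ := by
  obtain ⟨C₁, hC₁0, hC₁⟩ := h.exists_fderiv_bound
  obtain ⟨C₂, -, hC₂⟩ := h'.exists_fderiv_bound
  set C := max C₁ C₂
  have hC0 : 0 ≤ C := hC₁0.trans (le_max_left _ _)
  obtain ⟨χ, hχ⟩ := exists_isAnnularCutoff (E := EuclideanSpace ℝ (Fin m))
    (a := Real.exp (-(2 * (C * (r + 1)))) / 4) (by positivity) (4 * Real.exp (C * (r + 1)))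
  obtain ⟨D, N₀, hD⟩ := h.exists_forall_isDiscreteOrbit hC0
    (fun k hk w => (hC₁ k hk w).trans (le_max_left _ _)) hχ
  obtain ⟨D', N₀', hD'⟩ := h'.exists_forall_isDiscreteOrbit hC0
    (fun k hk w => (hC₂ k hk w).trans (le_max_right _ _)) hχ
  have key : ∀ᶠ N : ℕ in Filter.atTop, ⟪q, y⟫ ≤ ⟪q, y'⟫ + (D + D') * (N : ℝ)⁻¹ := by
    filter_upwards [Filter.eventually_ge_atTop (max N₀ N₀'), Filter.eventually_gt_atTop 0]
      with N hN hN0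
    obtain ⟨xs, ps, xs', ps', ho, ho', hact⟩ := exists_isDiscreteOrbit_le
      (contDiff_stepHam hχ (fun k => (h.isAdapted k).contDiff) N)
      (hasCompactSupport_stepHam hχ (fun k => (h.isAdapted k).hasCompactSupport) N)
      (contDiff_stepHam hχ (fun k => (h'.isAdapted k).contDiff) N)
      (hasCompactSupport_stepHam hχ (fun k => (h'.isAdapted k).hasCompactSupport) N)
      (fun i z => mul_le_mul_of_nonneg_left (coneHam_mono hχ (hle _) _) (by positivity))
      ((r + 1) * N) x q
    obtain ⟨hx, hs⟩ := hD N ((le_max_left _ _).trans hN) hN0 q xs ps hq ho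
    obtain ⟨hx', hs'⟩ := hD' N ((le_max_right _ _).trans hN) hN0 q xs' ps' hq ho'
    rw [Finset.sum_eq_zero fun i hi => hs i (Finset.mem_range.1 hi),
      Finset.sum_eq_zero fun i hi => hs' i (Finset.mem_range.1 hi), add_zero, add_zero] at hact
    have h1 := neg_le_of_abs_le (abs_real_inner_le_norm q (xs ((r + 1) * N) - y))
    have h2 := le_of_abs_le (abs_real_inner_le_norm q (xs' ((r + 1) * N) - y'))
    rw [inner_sub_right, hq, one_mul] at h1 h2
    linarith
  have hlim : Filter.Tendsto (fun N : ℕ => ⟪q, y'⟫ + (D + D') * (N : ℝ)⁻¹) Filter.atTop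
      (𝓝 ⟪q, y'⟫) := by
    simpa using (tendsto_inv_atTop_nhds_zero_nat (𝕜 := ℝ)).const_mul (D + D') |>.const_add ⟪q, y'⟫
  exact ge_of_tendsto hlim key

end Comparison

/-- After reparametrization in time, a non-negative isotopy is generated by a non-negative
Hamiltonian. -/
lemma NonnegST.exists_isAdapted {m : ℕ} {F : EuclideanSpace ℝ (Fin m) × ℝ → STSp m}
    (hnn : NonnegST m F) (hF : IsLegIsotopyST m F) :
    ∃ K, IsAdapted (fun z => F (z.1, Real.smoothTransition z.2)) K ∧ ∀ w, 0 ≤ K w := by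
  have hτ : ContDiff ℝ (⊤ : ℕ∞) Real.smoothTransition := Real.smoothTransition.contDiff
  refine (hF.comp_time hτ fun t _ => ⟨Real.smoothTransition.nonneg t,
    Real.smoothTransition.le_one t⟩).exists_isAdapted (convex_Ici 0) self_mem_Ici fun s hs t => ?_
  rw [legSpeed_comp_time hF.smooth (hτ.differentiable (by simp) t).hasDerivAt,
    legSpeed_eq_deriv hF.smooth]
  exact mul_nonneg Real.smoothTransition.monotone.deriv_nonneg
    (hnn s hs _ ⟨Real.smoothTransition.nonneg t, Real.smoothTransition.le_one t⟩)

theorem nonneg_isotopy_endpoints_legendrian_linked (m : ℕ) (hm : 2 ≤ m)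
    (F : EuclideanSpace ℝ (Fin m) × ℝ → STSp m)
    (hF : IsLegIsotopyST m F) (hnn : NonnegST m F)
    (hdisj : stSlice m F 0 ∩ stSlice m F 1 = ∅) :
    ∀ x y : EuclideanSpace ℝ (Fin m), x ≠ y →
      ¬ LegLinkIsotopic m (stSlice m F 0) (stSlice m F 1) (fib m x) (fib m y) := by
  rintro x y hxy ⟨G, G', hG, hG', hG0, hG'0, hG1, hG'1, hGG'⟩
  obtain ⟨KB, hKB, hKB0⟩ := hnn.exists_isAdapted hF
  obtain ⟨K, hK, hK'⟩ := exists_isAdapted_link hG hG' hGG'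
  have hrev := hG.comp_time (τ := fun t => 1 - t) (contDiff_const.sub contDiff_id)
    fun t ht => ⟨by linarith [ht.2], by linarith [ht.1]⟩
  have hconst := hF.comp_time (τ := fun _ => 0) contDiff_const fun t _ => ⟨le_rfl, zero_le_one⟩
  have htrans := hF.comp_time (τ := Real.smoothTransition) Real.smoothTransition.contDiff
    fun t _ => ⟨Real.smoothTransition.nonneg t, Real.smoothTransition.le_one t⟩
  have h : IsAdaptedChain
      (fun | 0 => fun z => G (z.1, 1 - z.2) | 1 => fun z => F (z.1, 0) | _ + 2 => G)
      (fun | 0 => fun w => -K (1 - w.1, w.2) | 1 => 0 | _ + 2 => K) 2 x x :=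
    { isLegIsotopy := fun | 0 => hrev | 1 => hconst | _ + 2 => hG
      isAdapted := fun
        | 0 => hK.reverse hG.smooth
        | 1 => isAdapted_const hF.smooth
        | _ + 2 => hK
      start := by rw [← hG1]; simp [stSlice]
      chain := fun
        | 0, _ => by
          have : stSlice m (fun z => G (z.1, 1 - z.2)) 1 = stSlice m G 0 := by simp [stSlice]
          exact (this.trans hG0).subset
        | 1, _ => hG0.symm.subset
      finish := hG1 }
  have h' : IsAdaptedChain
      (fun
        | 0 => fun z => G (z.1, 1 - z.2)
        | 1 => fun z => F (z.1, Real.smoothTransition z.2)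
        | _ + 2 => G')
      (fun | 0 => fun w => -K (1 - w.1, w.2) | 1 => KB | _ + 2 => K) 2 x y :=
    { isLegIsotopy := fun | 0 => hrev | 1 => htrans | _ + 2 => hG'
      isAdapted := fun | 0 => hK.reverse hG.smooth | 1 => hKB | _ + 2 => hK'
      start := by rw [← hG1]; simp [stSlice]
      chain := fun
        | 0, _ => by
          have h1 : stSlice m (fun z => G (z.1, 1 - z.2)) 1 = stSlice m G 0 := by simp [stSlice]
          have h2 : stSlice m (fun z => F (z.1, Real.smoothTransition z.2)) 0 = stSlice m F 0 := by
            simp [stSlice]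
          exact (h1.trans (hG0.trans h2.symm)).subset
        | 1, _ => by
          have : stSlice m (fun z => F (z.1, Real.smoothTransition z.2)) 1 = stSlice m F 1 := by
            simp [stSlice]
          exact (this.trans hG'0.symm).subset
      finish := hG'1 }
  have hne : x - y ≠ 0 := sub_ne_zero.2 hxy
  have hle := h.inner_le h' (q := ‖x - y‖⁻¹ • (x - y))
    (fun | 0, _ => le_rfl | 1, w => hKB0 w | _ + 2, _ => le_rfl) (by simp [norm_smul, hne])
  rw [← sub_nonpos, ← inner_sub_right, real_inner_smul_left, real_inner_self_eq_norm_sq] at hle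
  have : 0 < ‖x - y‖ := norm_pos_iff.2 hne
  have : 0 < ‖x - y‖⁻¹ * ‖x - y‖ ^ 2 := by positivity
  linarith
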